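/- arXiv:1109.3956 — 3 statements merged into one kernel-verified Lean document; each statement's English description precedes it below -/
import Mathlib

section
/- For every l ≥ 2, the set g^l = {g^l_{p,i,j} | 0 ≤ p ≤ l, (i,j) ∈ Z_n × Z_n} is contained in K_l = ∩_{s+t=l−2} X^s R X^t, forms a k-basis of K_l, and consequently dim_k K_l = (l+1)n². -/
/-- Generators of the path algebra of the torus-like quiver `Q̄`: idempotents `e (i,j)` for the
vertices `(i,j) ∈ Z_n × Z_n`, and arrows `a i j : (i,j) → (i,j+1)`, `b i j : (i,j) → (i+1,j)`. -/
inductive GenL (n : ℕ) : Type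
  | e : ZMod n × ZMod n → GenL n
  | a : ZMod n → ZMod n → GenL n
  | b : ZMod n → ZMod n → GenL n

variable (k : Type) [Field k] (n : ℕ) [NeZero n]

open FreeAlgebra in
/-- The path-algebra relations for the quiver `Q̄` (orthogonal idempotents summing to `1`,
with the arrows supported at their sources and targets). -/
inductive PRel : FreeAlgebra k (GenL n) → FreeAlgebra k (GenL n) → Prop
  | vert (v w : ZMod n × ZMod n) :
      PRel (ι k (GenL.e v) * ι k (GenL.e w)) (if v = w then ι k (GenL.e v) else 0)
  | unit : PRel (∑ v : ZMod n × ZMod n, ι k (GenL.e v)) 1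
  | srcA (i j) : PRel (ι k (GenL.e (i, j)) * ι k (GenL.a i j)) (ι k (GenL.a i j))
  | tgtA (i j) : PRel (ι k (GenL.a i j) * ι k (GenL.e (i, j + 1))) (ι k (GenL.a i j))
  | srcB (i j) : PRel (ι k (GenL.e (i, j)) * ι k (GenL.b i j)) (ι k (GenL.b i j))
  | tgtB (i j) : PRel (ι k (GenL.b i j) * ι k (GenL.e (i + 1, j))) (ι k (GenL.b i j))

/-- The path algebra `kQ̄`. -/
abbrev PA : Type := RingQuot (PRel k n)

/-- The image of a generator in `kQ̄`. -/
noncomputable def gP (g : GenL n) : PA k n :=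
  RingQuot.mkAlgHom k (PRel k n) (FreeAlgebra.ι k g)

/-- The arrow span `X = span_k{a_{ij}, b_{ij}}` in `kQ̄`. -/
noncomputable def Xspan : Submodule k (PA k n) :=
  Submodule.span k {x | ∃ i j, x = gP k n (GenL.a i j) ∨ x = gP k n (GenL.b i j)}

/-- The relation span
`R = span_k{a_{ij}a_{i,j+1}, b_{ij}b_{i+1,j}, a_{ij}b_{i,j+1} + q_{ij}b_{ij}a_{i+1,j}}`
in `kQ̄`. -/
noncomputable def Rspan (q : ZMod n → ZMod n → k) : Submodule k (PA k n) :=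
  Submodule.span k
    {x | ∃ i j, x = gP k n (GenL.a i j) * gP k n (GenL.a i (j + 1)) ∨
      x = gP k n (GenL.b i j) * gP k n (GenL.b (i + 1) j) ∨
      x = gP k n (GenL.a i j) * gP k n (GenL.b i (j + 1)) +
        q i j • (gP k n (GenL.b i j) * gP k n (GenL.a (i + 1) j))}

/-- `K_l = ∩_{s+t=l−2} X^s R X^t`. -/
noncomputable def Kbox (q : ZMod n → ZMod n → k) (l : ℕ) : Submodule k (PA k n) :=
  ⨅ s ∈ Finset.range (l - 1), Xspan k n ^ s * Rspan k n q * Xspan k n ^ (l - 2 - s)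

/-- The elements `g^l_{p,i,j}` of `kQ̄`: `g^0_{0,i,j} = e_{ij}`, `g^1_{0,i,j} = a_{ij}`,
`g^1_{1,i,j} = b_{ij}`, and recursively (with `g^l_{−1,i,j} = 0 = g^l_{l+1,i,j}`)
`g^l_{p,i,j} = a_{ij} g^{l−1}_{p,i,j+1} + q_{ij} q_{i,j+1} ⋯ q_{i,j+l−p−1} b_{ij}
g^{l−1}_{p−1,i+1,j}`. -/
noncomputable def gK (q : ZMod n → ZMod n → k) : ℕ → ℕ → ZMod n → ZMod n → PA k n
  | 0, p, i, j => if p = 0 then gP k n (GenL.e (i, j)) else 0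
  | 1, p, i, j =>
      if p = 0 then gP k n (GenL.a i j) else if p = 1 then gP k n (GenL.b i j) else 0
  | (l + 2), p, i, j =>
      gP k n (GenL.a i j) * gK q (l + 1) p i (j + 1) +
        if p = 0 then 0 else
          (∏ t ∈ Finset.range (l + 2 - p), q i (j + (t : ZMod n))) •
            (gP k n (GenL.b i j) * gK q (l + 1) (p - 1) (i + 1) j)

/-- The target of the arrow of type `x` (`false` for `a`, `true` for `b`) starting at `v`. -/
def step {n : ℕ} : Bool → ZMod n × ZMod n → ZMod n × ZMod n
  | false, v => (v.1, v.2 + 1)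
  | true, v => (v.1 + 1, v.2)

/-- The generator for the arrow of type `x` starting at `v`. -/
def arrGen {n : ℕ} : Bool → ZMod n × ZMod n → GenL n
  | false, v => GenL.a v.1 v.2
  | true, v => GenL.b v.1 v.2

/-- The arrow of type `x` starting at `v`, as an element of `kQ̄`. -/
noncomputable def arr (x : Bool) (v : ZMod n × ZMod n) : PA k n := gP k n (arrGen x v)

/-- The vertex idempotents act on functions of (source, word) by restriction of the source. -/
def vertOp (v : ZMod n × ZMod n) : Module.End k (ZMod n × ZMod n → List Bool → k) where
  toFun f u w := if u = v then f u w else 0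
  map_add' f g := by
    funext u w
    by_cases h : u = v <;> simp [h]
  map_smul' c f := by
    funext u w
    by_cases h : u = v <;> simp [h]

/-- The arrows act on functions of (source, word) by prepending a letter. -/
def arrOp (x : Bool) (v : ZMod n × ZMod n) :
    Module.End k (ZMod n × ZMod n → List Bool → k) where
  toFun f u
    | [] => 0
    | y :: w => if y = x ∧ u = v then f (step x u) w else 0
  map_add' f g := by
    funext u w
    cases w with
    | nil => simp
    | cons y w => by_cases h : y = x ∧ u = v <;> simp [h]
  map_smul' c f := by
    funext u w
    cases w with
    | nil => simp
    | cons y w => by_cases h : y = x ∧ u = v <;> simp [h]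

/-- The action of the generators of `kQ̄`. -/
def genOp : GenL n → Module.End k (ZMod n × ZMod n → List Bool → k)
  | GenL.e v => vertOp k n v
  | GenL.a i j => arrOp k n false (i, j)
  | GenL.b i j => arrOp k n true (i, j)

theorem vertOp_mul_arrOp (x : Bool) (v : ZMod n × ZMod n) :
    vertOp k n v * arrOp k n x v = arrOp k n x v := by
  refine LinearMap.ext fun f => funext fun u => funext fun w => ?_
  cases w with
  | nil => simp [vertOp, arrOp]
  | cons y w => by_cases h : u = v <;> simp [vertOp, arrOp, h]

theorem arrOp_mul_vertOp (x : Bool) (v : ZMod n × ZMod n) :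
    arrOp k n x v * vertOp k n (step x v) = arrOp k n x v := by
  refine LinearMap.ext fun f => funext fun u => funext fun w => ?_
  cases w with
  | nil => simp [arrOp]
  | cons y w => by_cases h : u = v <;> simp [vertOp, arrOp, h]

theorem lift_genOp_of_rel {x y : FreeAlgebra k (GenL n)} (h : PRel k n x y) :
    FreeAlgebra.lift k (genOp k n) x = FreeAlgebra.lift k (genOp k n) y := by
  cases h with
  | vert v w =>
    rw [apply_ite (FreeAlgebra.lift k (genOp k n)), map_mul, map_zero]
    simp only [FreeAlgebra.lift_ι_apply, genOp]
    refine LinearMap.ext fun f => funext fun u => funext fun z => ?_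
    by_cases h : v = w
    · subst h
      by_cases h' : u = v <;> simp [vertOp, h']
    · by_cases h' : u = v
      · subst h'
        simp [vertOp, h]
      · simp [vertOp, h, h']
  | unit =>
    rw [map_sum, map_one]
    simp only [FreeAlgebra.lift_ι_apply, genOp]
    refine LinearMap.ext fun f => funext fun u => funext fun z => ?_
    simp [vertOp, LinearMap.sum_apply, Finset.sum_apply]
  | srcA i j => simpa [genOp] using vertOp_mul_arrOp k n false (i, j)
  | tgtA i j =>
    rw [map_mul]
    simp only [FreeAlgebra.lift_ι_apply, genOp]
    exact arrOp_mul_vertOp k n false (i, j)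
  | srcB i j => simpa [genOp] using vertOp_mul_arrOp k n true (i, j)
  | tgtB i j =>
    rw [map_mul]
    simp only [FreeAlgebra.lift_ι_apply, genOp]
    exact arrOp_mul_vertOp k n true (i, j)

/-- The representation of `kQ̄` on functions of (source, word). -/
noncomputable def pathRep : PA k n →ₐ[k] Module.End k (ZMod n × ZMod n → List Bool → k) :=
  RingQuot.liftAlgHom k ⟨FreeAlgebra.lift k (genOp k n), fun _ _ h => lift_genOp_of_rel k n h⟩

theorem pathRep_gP (g : GenL n) : pathRep k n (gP k n g) = genOp k n g := by
  simp [pathRep, gP, RingQuot.liftAlgHom_mkAlgHom_apply]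

theorem pathRep_arr (x : Bool) (v : ZMod n × ZMod n) :
    pathRep k n (arr k n x v) = arrOp k n x v := by
  cases x <;> exact pathRep_gP k n _

/-- The coefficient in an element of `kQ̄` of the path with source `v` and word `w`. -/
noncomputable def coef (v : ZMod n × ZMod n) (w : List Bool) : PA k n →ₗ[k] k where
  toFun z := pathRep k n z (fun _ u => if u = [] then 1 else 0) v w
  map_add' y z := by simp
  map_smul' c z := by simp

theorem coef_nil_arr_mul (v v' : ZMod n × ZMod n) (x : Bool) (z : PA k n) :
    coef k n v [] (arr k n x v' * z) = 0 := by
  simp [coef, pathRep_arr, arrOp]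

theorem coef_cons_arr_mul (v v' : ZMod n × ZMod n) (x y : Bool) (w : List Bool) (z : PA k n) :
    coef k n v (y :: w) (arr k n x v' * z) =
      if y = x ∧ v = v' then coef k n (step x v) w z else 0 := by
  simp [coef, pathRep_arr, arrOp]

theorem coef_vert (v v' : ZMod n × ZMod n) (w : List Bool) :
    coef k n v w (gP k n (GenL.e v')) = if v = v' ∧ w = [] then 1 else 0 := by
  by_cases h : v = v' <;> simp [coef, pathRep_gP, genOp, vertOp, h]

theorem gP_vert_mul_vert (v w : ZMod n × ZMod n) :
    gP k n (GenL.e v) * gP k n (GenL.e w) = if v = w then gP k n (GenL.e v) else 0 := by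
  have h := RingQuot.mkAlgHom_rel k (PRel.vert (k := k) v w)
  rw [map_mul, apply_ite (RingQuot.mkAlgHom k (PRel k n)), map_zero] at h
  exact h

theorem sum_gP_vert : ∑ v : ZMod n × ZMod n, gP k n (GenL.e v) = 1 := by
  have h := RingQuot.mkAlgHom_rel k (PRel.unit (k := k) (n := n))
  rw [map_sum, map_one] at h
  exact h

theorem vert_mul_arr (x : Bool) (v : ZMod n × ZMod n) :
    gP k n (GenL.e v) * arr k n x v = arr k n x v := by
  cases x
  · have h := RingQuot.mkAlgHom_rel k (PRel.srcA (k := k) v.1 v.2)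
    rw [map_mul] at h
    exact h
  · have h := RingQuot.mkAlgHom_rel k (PRel.srcB (k := k) v.1 v.2)
    rw [map_mul] at h
    exact h

theorem arr_mul_vert (x : Bool) (v : ZMod n × ZMod n) :
    arr k n x v * gP k n (GenL.e (step x v)) = arr k n x v := by
  cases x
  · have h := RingQuot.mkAlgHom_rel k (PRel.tgtA (k := k) v.1 v.2)
    rw [map_mul] at h
    exact h
  · have h := RingQuot.mkAlgHom_rel k (PRel.tgtB (k := k) v.1 v.2)
    rw [map_mul] at h
    exact h

/-- The path with source `v` and word `w`, as an element of `kQ̄`. -/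
noncomputable def pathElt : ZMod n × ZMod n → List Bool → PA k n
  | v, [] => gP k n (GenL.e v)
  | v, x :: w => arr k n x v * pathElt (step x v) w

theorem coef_pathElt (v v' : ZMod n × ZMod n) (w w' : List Bool) :
    coef k n v w (pathElt k n v' w') = if v = v' ∧ w = w' then 1 else 0 := by
  induction w' generalizing v v' w with
  | nil => exact coef_vert k n v v' w
  | cons x w' ih =>
    cases w with
    | nil => simp [pathElt, coef_nil_arr_mul]
    | cons y w =>
      rw [pathElt, coef_cons_arr_mul, ih]
      by_cases h : v = v'
      · subst h
        by_cases h' : y = x <;> simp [h']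
      · simp [h]

theorem vert_mul_pathElt (v : ZMod n × ZMod n) (w : List Bool) :
    gP k n (GenL.e v) * pathElt k n v w = pathElt k n v w := by
  cases w with
  | nil => simp [pathElt, gP_vert_mul_vert]
  | cons x w => rw [pathElt, ← mul_assoc, vert_mul_arr]

theorem arr_mul_pathElt (x : Bool) (v v' : ZMod n × ZMod n) (w : List Bool) :
    arr k n x v * pathElt k n v' w = if step x v = v' then pathElt k n v (x :: w) else 0 := by
  by_cases h : step x v = v'
  · simp [h, pathElt]
  · rw [← arr_mul_vert, ← vert_mul_pathElt, mul_assoc, ← mul_assoc (gP k n _) (gP k n _),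
      gP_vert_mul_vert]
    simp [h]

/-- The span of all paths. -/
noncomputable def pathSpan : Submodule k (PA k n) :=
  Submodule.span k (Set.range fun p : (ZMod n × ZMod n) × List Bool => pathElt k n p.1 p.2)

theorem arr_mem_Xspan (x : Bool) (v : ZMod n × ZMod n) : arr k n x v ∈ Xspan k n := by
  refine Submodule.subset_span ⟨v.1, v.2, ?_⟩
  cases x
  · exact Or.inl rfl
  · exact Or.inr rfl

theorem Xspan_eq : Xspan k n = Submodule.span k
    (Set.range fun p : Bool × (ZMod n × ZMod n) => arr k n p.1 p.2) := by
  refine le_antisymm (Submodule.span_le.2 ?_) (Submodule.span_le.2 ?_)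
  · rintro _ ⟨i, j, rfl | rfl⟩
    · exact Submodule.subset_span ⟨(false, (i, j)), rfl⟩
    · exact Submodule.subset_span ⟨(true, (i, j)), rfl⟩
  · rintro _ ⟨p, rfl⟩
    exact arr_mem_Xspan k n p.1 p.2

/-- To bound `X * S` it suffices to consider left multiplication by arrows. -/
theorem Xspan_mul_le {S T : Submodule k (PA k n)}
    (h : ∀ x v, ∀ z ∈ S, arr k n x v * z ∈ T) : Xspan k n * S ≤ T := by
  rw [Xspan_eq, ← Submodule.span_eq S, Submodule.span_mul_span, Submodule.span_le]
  rintro _ ⟨_, ⟨p, rfl⟩, z, hz, rfl⟩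
  exact h p.1 p.2 z hz

theorem Xspan_mul_pathSpan_le : Xspan k n * pathSpan k n ≤ pathSpan k n := by
  refine Xspan_mul_le k n fun x v z hz => ?_
  have hle : pathSpan k n ≤ (pathSpan k n).comap (LinearMap.mulLeft k (arr k n x v)) := by
    refine Submodule.span_le.2 ?_
    rintro _ ⟨p, rfl⟩
    change arr k n x v * pathElt k n p.1 p.2 ∈ pathSpan k n
    rw [arr_mul_pathElt]
    split_ifs
    · exact Submodule.subset_span ⟨(v, x :: p.2), rfl⟩
    · exact zero_mem _
  exact hle hz

theorem Xspan_pow_le_pathSpan (l : ℕ) : Xspan k n ^ l ≤ pathSpan k n := by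
  induction l with
  | zero =>
    rw [pow_zero, Submodule.one_le, ← sum_gP_vert]
    exact sum_mem fun v _ => Submodule.subset_span ⟨(v, []), rfl⟩
  | succ l ih =>
    rw [pow_succ']
    exact (mul_le_mul_right ih _).trans (Xspan_mul_pathSpan_le k n)

theorem eq_zero_of_coef_eq_zero {z : PA k n} (hz : z ∈ pathSpan k n)
    (h : ∀ v w, coef k n v w z = 0) : z = 0 := by
  obtain ⟨c, rfl⟩ := (Finsupp.mem_span_range_iff_exists_finsupp).1 hz
  have hc : c = 0 := by
    ext ⟨v, w⟩
    have := h v w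
    simp only [Finsupp.sum, map_sum, map_smul, coef_pathElt] at this
    rw [Finset.sum_eq_single (v, w)] at this
    · simpa using this
    · rintro ⟨v', w'⟩ - hne
      have : ¬ (v = v' ∧ w = w') := fun h => hne (by rw [h.1, h.2])
      simp [this]
    · intro hn
      simpa using hn
  simp [hc]

theorem coef_eq_zero_of_mem_pow {l : ℕ} {z : PA k n} (hz : z ∈ Xspan k n ^ l)
    (v : ZMod n × ZMod n) {w : List Bool} (hw : w.length ≠ l) : coef k n v w z = 0 := by
  induction l generalizing z v w with
  | zero =>
    rw [pow_zero, Submodule.mem_one] at hz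
    obtain ⟨c, rfl⟩ := hz
    rw [Algebra.algebraMap_eq_smul_one, ← sum_gP_vert]
    have : w ≠ [] := by simpa using hw
    simp [coef_vert, this]
  | succ l ih =>
    rw [pow_succ'] at hz
    have hle : Xspan k n * Xspan k n ^ l ≤ LinearMap.ker (coef k n v w) := by
      refine Xspan_mul_le k n fun x v' y hy => ?_
      rw [LinearMap.mem_ker]
      cases w with
      | nil => exact coef_nil_arr_mul k n v v' x y
      | cons x' w =>
        rw [coef_cons_arr_mul, ih hy _ (by simpa using hw), ite_self]
    exact hle hz

section

variable (q : ZMod n → ZMod n → k)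

theorem aa_mem_Rspan (v : ZMod n × ZMod n) :
    arr k n false v * arr k n false (step false v) ∈ Rspan k n q :=
  Submodule.subset_span ⟨v.1, v.2, Or.inl rfl⟩

theorem bb_mem_Rspan (v : ZMod n × ZMod n) :
    arr k n true v * arr k n true (step true v) ∈ Rspan k n q :=
  Submodule.subset_span ⟨v.1, v.2, Or.inr (Or.inl rfl)⟩

theorem ab_mem_Rspan (v : ZMod n × ZMod n) :
    arr k n false v * arr k n true (step false v) +
      q v.1 v.2 • (arr k n true v * arr k n false (step true v)) ∈ Rspan k n q :=
  Submodule.subset_span ⟨v.1, v.2, Or.inr (Or.inr rfl)⟩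

/-- To bound `R * S` it suffices to consider left multiplication by the defining relations. -/
theorem Rspan_mul_le {S T : Submodule k (PA k n)}
    (haa : ∀ v, ∀ z ∈ S, arr k n false v * (arr k n false (step false v) * z) ∈ T)
    (hbb : ∀ v, ∀ z ∈ S, arr k n true v * (arr k n true (step true v) * z) ∈ T)
    (hab : ∀ v, ∀ z ∈ S, arr k n false v * (arr k n true (step false v) * z) +
      q v.1 v.2 • (arr k n true v * (arr k n false (step true v) * z)) ∈ T) :
    Rspan k n q * S ≤ T := by
  rw [Rspan, ← Submodule.span_eq S, Submodule.span_mul_span, Submodule.span_le]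
  rintro _ ⟨_, ⟨i, j, rfl | rfl | rfl⟩, z, hz, rfl⟩
  · simp only [mul_assoc]
    exact haa (i, j) z hz
  · simp only [mul_assoc]
    exact hbb (i, j) z hz
  · simp only [add_mul, smul_mul_assoc, mul_assoc]
    exact hab (i, j) z hz

theorem Rspan_mul_pow_le (t : ℕ) : Rspan k n q * Xspan k n ^ t ≤ Xspan k n ^ (t + 2) := by
  have h : ∀ x y v w, ∀ z ∈ Xspan k n ^ t, arr k n x v * (arr k n y w * z) ∈
      Xspan k n ^ (t + 2) := fun x y v w z hz => by
    rw [pow_succ', pow_succ']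
    exact Submodule.mul_mem_mul (arr_mem_Xspan k n x v)
      (Submodule.mul_mem_mul (arr_mem_Xspan k n y w) hz)
  exact Rspan_mul_le k n q (fun v z hz => h _ _ _ _ z hz) (fun v z hz => h _ _ _ _ z hz)
    (fun v z hz => add_mem (h _ _ _ _ z hz) (Submodule.smul_mem _ _ (h _ _ _ _ z hz)))

/-- The relations force the coefficients of words differing by a transposition of adjacent
letters to be proportional. -/
theorem coef_swap_of_mem (s : ℕ) {S : Submodule k (PA k n)} {z : PA k n}
    (hz : z ∈ Xspan k n ^ s * (Rspan k n q * S))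
    (v : ZMod n × ZMod n) {u : List Bool} (hu : u.length = s) (u' : List Bool) :
    coef k n v (u ++ true :: false :: u') z =
      q (u.foldl (fun v x => step x v) v).1 (u.foldl (fun v x => step x v) v).2 *
        coef k n v (u ++ false :: true :: u') z := by
  induction s generalizing z v u with
  | zero =>
    obtain rfl := List.length_eq_zero_iff.1 hu
    rw [pow_zero, one_mul] at hz
    have hle : Rspan k n q * S ≤ LinearMap.eqLocus (coef k n v (true :: false :: u'))
        (q v.1 v.2 • coef k n v (false :: true :: u')) := by
      refine Rspan_mul_le k n q (fun v' z _ => ?_) (fun v' z _ => ?_) (fun v' z _ => ?_)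
      · simp [LinearMap.mem_eqLocus, coef_cons_arr_mul]
      · simp [LinearMap.mem_eqLocus, coef_cons_arr_mul]
      · by_cases h : v = v'
        · subst h
          have : step true (step false v) = step false (step true v) := rfl
          simp [LinearMap.mem_eqLocus, coef_cons_arr_mul, this]
        · simp [LinearMap.mem_eqLocus, coef_cons_arr_mul, h]
    exact hle hz
  | succ s ih =>
    cases u with
    | nil => simp at hu
    | cons x u =>
      rw [pow_succ', mul_assoc] at hz
      set c := (x :: u).foldl (fun v x => step x v) v with hc
      have hle : Xspan k n * (Xspan k n ^ s * (Rspan k n q * S)) ≤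
          LinearMap.eqLocus (coef k n v (x :: u ++ true :: false :: u'))
            (q c.1 c.2 • coef k n v (x :: u ++ false :: true :: u')) := by
        refine Xspan_mul_le k n fun y v' z hz => ?_
        rw [LinearMap.mem_eqLocus, LinearMap.smul_apply, List.cons_append, List.cons_append,
          coef_cons_arr_mul, coef_cons_arr_mul]
        split_ifs with h
        · obtain ⟨rfl, rfl⟩ := h
          exact ih hz _ (by simpa using hu)
        · simp
      exact hle hz

theorem mem_Kbox_iff {l : ℕ} {z : PA k n} : z ∈ Kbox k n q l ↔
    ∀ s < l - 1, z ∈ Xspan k n ^ s * (Rspan k n q * Xspan k n ^ (l - 2 - s)) := by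
  simp [Kbox, Submodule.mem_iInf, mul_assoc]

theorem Kbox_le_pow {l : ℕ} (hl : 2 ≤ l) : Kbox k n q l ≤ Xspan k n ^ l := by
  intro z hz
  have h := (mem_Kbox_iff k n q).1 hz 0 (by omega)
  rw [pow_zero, one_mul] at h
  have := Rspan_mul_pow_le k n q _ h
  rwa [show l - 2 - 0 + 2 = l by omega] at this

theorem coef_perm {l : ℕ} (hq : ∀ i j, q i j ≠ 0) {z : PA k n} (hz : z ∈ Kbox k n q l)
    (v : ZMod n × ZMod n) {w w' : List Bool} (h : w.Perm w') (u : List Bool)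
    (hlen : u.length + w.length = l) :
    coef k n v (u ++ w) z = 0 ↔ coef k n v (u ++ w') z = 0 := by
  induction h generalizing u with
  | nil => rfl
  | cons x _ ih =>
    have := ih (u ++ [x]) (by simp at hlen ⊢; omega)
    simpa using this
  | swap x y w =>
    simp only [List.length_cons] at hlen
    have hsw := coef_swap_of_mem k n q u.length
      ((mem_Kbox_iff k n q).1 hz u.length (by omega)) v rfl w
    cases x <;> cases y
    · rfl
    · rw [hsw]
      simp [hq]
    · rw [hsw]
      simp [hq]
    · rfl
  | trans h₁ _ ih₁ ih₂ =>
    exact (ih₁ u hlen).trans (ih₂ u (by rw [← h₁.length_eq]; exact hlen))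

/-- The word `a ⋯ a b ⋯ b` of length `l` with `p` letters `b`. -/
def sortedWord (l p : ℕ) : List Bool :=
  List.replicate (l - p) false ++ List.replicate p true

theorem perm_sortedWord (w : List Bool) : w.Perm (sortedWord w.length (w.count true)) := by
  rw [List.perm_iff_count]
  have := List.count_true_add_count_false w
  intro x
  cases x <;> simp [sortedWord, List.count_replicate]
  omega

theorem eq_zero_of_sorted_coef {l : ℕ} (hl : 2 ≤ l) (hq : ∀ i j, q i j ≠ 0) {z : PA k n}
    (hz : z ∈ Kbox k n q l) (h : ∀ v, ∀ p ≤ l, coef k n v (sortedWord l p) z = 0) : z = 0 := by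
  have hX := Kbox_le_pow k n q hl hz
  refine eq_zero_of_coef_eq_zero k n (Xspan_pow_le_pathSpan k n l hX) fun v w => ?_
  by_cases hw : w.length = l
  · subst hw
    exact (coef_perm k n q hq hz v (perm_sortedWord w) [] (by simp)).2
      (h v _ List.count_le_length)
  · exact coef_eq_zero_of_mem_pow k n hX v hw

theorem gK_zero (p : ℕ) (i j : ZMod n) :
    gK k n q 0 p i j = if p = 0 then gP k n (GenL.e (i, j)) else 0 := by
  rw [gK]

/-- The recursion for `g^l`, valid from `l = 1` on. -/
theorem gK_succ (l p : ℕ) (v : ZMod n × ZMod n) :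
    gK k n q (l + 1) p v.1 v.2 =
      arr k n false v * gK k n q l p (step false v).1 (step false v).2 +
        if p = 0 then 0 else
          (∏ t ∈ Finset.range (l + 1 - p), q v.1 (v.2 + (t : ZMod n))) •
            (arr k n true v * gK k n q l (p - 1) (step true v).1 (step true v).2) := by
  cases l with
  | zero =>
    rw [gK_zero, gK_zero, gK, Prod.mk.eta, Prod.mk.eta]
    rcases p with _ | _ | p
    · simp [arr_mul_vert]
      rfl
    · simp [arr_mul_vert]
      rfl
    · simp
  | succ l => rw [gK]; rfl

theorem gK_eq_zero {l p : ℕ} (h : l < p) (v : ZMod n × ZMod n) : gK k n q l p v.1 v.2 = 0 := by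
  induction l generalizing p v with
  | zero => rw [gK_zero, if_neg (by omega)]
  | succ l ih => rw [gK_succ, ih (by omega), ih (by omega)]; simp

/-- Expanding the recursion twice reduces membership of `g^{l+2}` to the defining relations. -/
theorem gK_add_two_mem (l p : ℕ) (v : ZMod n × ZMod n) {T : Submodule k (PA k n)}
    (haa : ∀ p v, arr k n false v * (arr k n false (step false v) *
      gK k n q l p (step false (step false v)).1 (step false (step false v)).2) ∈ T)
    (hbb : ∀ p v, arr k n true v * (arr k n true (step true v) *
      gK k n q l p (step true (step true v)).1 (step true (step true v)).2) ∈ T)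
    (hab : ∀ p v, arr k n false v * (arr k n true (step false v) *
        gK k n q l p (step true (step false v)).1 (step true (step false v)).2) +
      q v.1 v.2 • (arr k n true v * (arr k n false (step true v) *
        gK k n q l p (step true (step false v)).1 (step true (step false v)).2)) ∈ T) :
    gK k n q (l + 2) p v.1 v.2 ∈ T := by
  have hcomm : step false (step true v) = step true (step false v) := rfl
  rw [gK_succ, gK_succ, gK_succ, hcomm]
  cases p with
  | zero => simpa using haa 0 v
  | succ p =>
    simp only [Nat.add_one_ne_zero, if_false, Nat.add_sub_cancel, mul_add, smul_add,
      mul_smul_comm]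
    have hmid : (∏ t ∈ Finset.range (l + 1 - (p + 1)),
          q (step false v).1 ((step false v).2 + (t : ZMod n))) •
            (arr k n false v * (arr k n true (step false v) *
              gK k n q l p (step true (step false v)).1 (step true (step false v)).2)) +
        (∏ t ∈ Finset.range (l + 1 + 1 - (p + 1)), q v.1 (v.2 + (t : ZMod n))) •
          (arr k n true v * (arr k n false (step true v) *
            gK k n q l p (step true (step false v)).1 (step true (step false v)).2)) ∈ T := by
      rcases lt_or_ge l p with h | h
      · simp [gK_eq_zero k n q h]
      · rw [show l + 1 + 1 - (p + 1) = (l + 1 - (p + 1)) + 1 by omega, Finset.prod_range_succ',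
          mul_smul, Nat.cast_zero, add_zero]
        have hprod : ∏ t ∈ Finset.range (l + 1 - (p + 1)),
            q v.1 (v.2 + ((t + 1 : ℕ) : ZMod n)) = ∏ t ∈ Finset.range (l + 1 - (p + 1)),
            q (step false v).1 ((step false v).2 + (t : ZMod n)) :=
          Finset.prod_congr rfl fun t _ => by simp [step, add_comm, add_left_comm]
        rw [hprod, ← smul_add]
        exact Submodule.smul_mem _ _ (hab p v)
    rw [add_assoc, ← add_assoc (_ • _) (_ • _)]
    refine add_mem (haa _ v) (add_mem hmid (Submodule.smul_mem _ _ ?_))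
    split_ifs
    · simp
    · rw [mul_smul_comm]
      exact Submodule.smul_mem _ _ (hbb _ v)

theorem gK_succ_mem {S : Submodule k (PA k n)} (l p : ℕ) (v : ZMod n × ZMod n)
    (h : ∀ p (v : ZMod n × ZMod n), gK k n q l p v.1 v.2 ∈ S) :
    gK k n q (l + 1) p v.1 v.2 ∈ Xspan k n * S := by
  rw [gK_succ]
  refine add_mem (Submodule.mul_mem_mul (arr_mem_Xspan k n _ _) (h _ _)) ?_
  split_ifs
  · exact zero_mem _
  · exact Submodule.smul_mem _ _ (Submodule.mul_mem_mul (arr_mem_Xspan k n _ _) (h _ _))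

theorem gK_succ_mem_pow (l p : ℕ) (v : ZMod n × ZMod n) :
    gK k n q (l + 1) p v.1 v.2 ∈ Xspan k n ^ (l + 1) := by
  induction l generalizing p v with
  | zero =>
    rw [zero_add, pow_one, gK]
    split_ifs
    · exact arr_mem_Xspan k n false v
    · exact arr_mem_Xspan k n true v
    · exact zero_mem _
  | succ l ih =>
    rw [pow_succ']
    exact gK_succ_mem k n q _ p v ih

theorem gK_mem_Rspan_mul (t p : ℕ) (v : ZMod n × ZMod n) :
    gK k n q (t + 2) p v.1 v.2 ∈ Rspan k n q * Xspan k n ^ t := by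
  cases t with
  | zero =>
    rw [pow_zero, mul_one]
    refine gK_add_two_mem k n q 0 p v (fun p v => ?_) (fun p v => ?_) (fun p v => ?_) <;>
      rw [gK_zero] <;> split_ifs
    · rw [Prod.mk.eta, arr_mul_vert]
      exact aa_mem_Rspan k n q v
    · simp
    · rw [Prod.mk.eta, arr_mul_vert]
      exact bb_mem_Rspan k n q v
    · simp
    · have hcomm : step true (step false v) = step false (step true v) := rfl
      rw [Prod.mk.eta, arr_mul_vert, hcomm, arr_mul_vert]
      exact ab_mem_Rspan k n q v
    · simp
  | succ t =>
    refine gK_add_two_mem k n q (t + 1) p v (fun p v => ?_) (fun p v => ?_) (fun p v => ?_)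
    · rw [← mul_assoc]
      exact Submodule.mul_mem_mul (aa_mem_Rspan k n q v) (gK_succ_mem_pow k n q _ _ _)
    · rw [← mul_assoc]
      exact Submodule.mul_mem_mul (bb_mem_Rspan k n q v) (gK_succ_mem_pow k n q _ _ _)
    · rw [← mul_assoc, ← mul_assoc, ← smul_mul_assoc, ← add_mul]
      exact Submodule.mul_mem_mul (ab_mem_Rspan k n q v) (gK_succ_mem_pow k n q _ _ _)

theorem gK_mem_Kbox {l : ℕ} (hl : 2 ≤ l) (p : ℕ) (v : ZMod n × ZMod n) :
    gK k n q l p v.1 v.2 ∈ Kbox k n q l := by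
  have key : ∀ s t p (v : ZMod n × ZMod n), gK k n q (t + 2 + s) p v.1 v.2 ∈
      Xspan k n ^ s * (Rspan k n q * Xspan k n ^ t) := by
    intro s t
    induction s with
    | zero =>
      intro p v
      rw [pow_zero, one_mul]
      exact gK_mem_Rspan_mul k n q t p v
    | succ s ih =>
      intro p v
      rw [pow_succ', mul_assoc]
      exact gK_succ_mem k n q _ p v ih
  rw [mem_Kbox_iff]
  intro s hs
  have := key s (l - 2 - s) p v
  rwa [show l - 2 - s + 2 + s = l by omega] at this

theorem coef_sortedWord_gK {l p : ℕ} (hp : p ≤ l) (p' : ℕ) (v v' : ZMod n × ZMod n) :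
    coef k n v (sortedWord l p) (gK k n q l p' v'.1 v'.2) =
      if p = p' ∧ v = v' then 1 else 0 := by
  induction l generalizing p p' v v' with
  | zero =>
    obtain rfl := Nat.le_zero.1 hp
    by_cases h : p' = 0
    · simp [gK_zero, sortedWord, coef_vert, h]
    · simp [gK_zero, h, Ne.symm h]
  | succ l ih =>
    rw [gK_succ, map_add, apply_ite (coef k n v (sortedWord (l + 1) p)), map_smul, map_zero]
    rcases Nat.lt_or_ge l p with h | h
    · obtain rfl : p = l + 1 := le_antisymm hp h
      have hw : sortedWord (l + 1) (l + 1) = true :: sortedWord l l := by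
        simp [sortedWord, List.replicate_succ]
      rw [hw, coef_cons_arr_mul, coef_cons_arr_mul]
      by_cases hv : v = v'
      · subst hv
        rcases p' with _ | p'
        · simp
        · by_cases hp' : l = p'
          · subst hp'
            simp [ih le_rfl]
          · simp [ih le_rfl, hp']
      · simp [hv]
    · have hw : sortedWord (l + 1) p = false :: sortedWord l p := by
        simp [sortedWord, Nat.succ_sub h, List.replicate_succ]
      rw [hw, coef_cons_arr_mul, coef_cons_arr_mul]
      by_cases hv : v = v'
      · subst hv
        simp [ih h]
      · simp [hv]

theorem coef_sortedWord_sum {l : ℕ} (c : Fin (l + 1) × ZMod n × ZMod n → k)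
    (y : Fin (l + 1) × ZMod n × ZMod n) :
    coef k n y.2 (sortedWord l y.1) (∑ x, c x • gK k n q l (x.1 : ℕ) x.2.1 x.2.2) = c y := by
  rw [map_sum, Finset.sum_eq_single y]
  · simp [coef_sortedWord_gK k n q (Nat.lt_succ_iff.1 y.1.2)]
  · intro x _ hxy
    rw [map_smul, coef_sortedWord_gK k n q (Nat.lt_succ_iff.1 y.1.2), if_neg, smul_zero]
    exact fun h => hxy (Prod.ext (Fin.ext h.1.symm) h.2.symm)
  · simp

end

/-- **Statement 7.**  For every `l ≥ 2` the set `g^l = {g^l_{p,i,j} | 0 ≤ p ≤ l}` is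
contained in `K_l = ∩_{s+t=l−2} X^s R X^t`, forms a `k`-basis of `K_l`, and consequently
`dim_k K_l = (l+1) n²`. -/
theorem stmt_7 (k : Type) [Field k] (n : ℕ) [NeZero n] (hn : 3 ≤ n)
    (q : ZMod n → ZMod n → k) (hq : ∀ i j, q i j ≠ 0) :
    ∀ l : ℕ, 2 ≤ l →
      (∀ p : ℕ, p ≤ l → ∀ i j : ZMod n, gK k n q l p i j ∈ Kbox k n q l) ∧
      LinearIndependent k
        (fun x : Fin (l + 1) × ZMod n × ZMod n => gK k n q l (x.1 : ℕ) x.2.1 x.2.2) ∧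
      Submodule.span k
        (Set.range fun x : Fin (l + 1) × ZMod n × ZMod n =>
          gK k n q l (x.1 : ℕ) x.2.1 x.2.2) = Kbox k n q l ∧
      Module.finrank k (Kbox k n q l) = (l + 1) * n ^ 2 := by
  intro l hl
  have hmem : ∀ p : ℕ, p ≤ l → ∀ i j : ZMod n, gK k n q l p i j ∈ Kbox k n q l :=
    fun p _ i j => gK_mem_Kbox k n q hl p (i, j)
  have hli : LinearIndependent k
      (fun x : Fin (l + 1) × ZMod n × ZMod n => gK k n q l (x.1 : ℕ) x.2.1 x.2.2) := by
    rw [Fintype.linearIndependent_iff]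
    intro c hc y
    have := congrArg (coef k n y.2 (sortedWord l y.1)) hc
    rwa [coef_sortedWord_sum, map_zero] at this
  have hspan : Submodule.span k (Set.range fun x : Fin (l + 1) × ZMod n × ZMod n =>
      gK k n q l (x.1 : ℕ) x.2.1 x.2.2) = Kbox k n q l := by
    refine le_antisymm (Submodule.span_le.2 ?_) fun z hz => ?_
    · rintro _ ⟨x, rfl⟩
      exact hmem x.1 (Nat.lt_succ_iff.1 x.1.2) x.2.1 x.2.2
    · have hsum : ∑ x : Fin (l + 1) × ZMod n × ZMod n,
          coef k n x.2 (sortedWord l x.1) z • gK k n q l (x.1 : ℕ) x.2.1 x.2.2 ∈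
            Kbox k n q l :=
        sum_mem fun x _ => Submodule.smul_mem _ _
          (hmem x.1 (Nat.lt_succ_iff.1 x.1.2) x.2.1 x.2.2)
      have hz0 := eq_zero_of_sorted_coef k n q hl hq (sub_mem hz hsum) fun v p hp => by
        have := coef_sortedWord_sum k n q
          (fun x : Fin (l + 1) × ZMod n × ZMod n => coef k n x.2 (sortedWord l x.1) z)
          (⟨p, Nat.lt_succ_iff.2 hp⟩, v)
        rw [map_sub, this, sub_self]
      rw [sub_eq_zero.1 hz0]
      exact sum_mem fun x _ => Submodule.smul_mem _ _ (Submodule.subset_span ⟨x, rfl⟩)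
  refine ⟨hmem, hli, hspan, ?_⟩
  rw [← hspan, finrank_span_eq_card hli]
  simp [ZMod.card, sq]
end

section
/- For every l ≥ 0, the dimension dim_k M^l = dim_k k(g^l // B), i.e. the number of pairs (g^l_{p,i,j}, x) with x ∈ B parallel to g^l_{p,i,j} (same source and same target in the quiver Q̄), equals: (l₀+1)n² if l = l₀n for some integer l₀ ≥ 0; 2(l₀+1)n² if l = l₀n + 1 for some integer l₀ ≥ 0; (l₀+1)n² if l = l₀n + 2 for some integer l₀ ≥ 0; and 0 otherwise. -/
/-- The source of the basis element `g^l_{p,i,j}` of the Koszul complex: the vertex `(i,j)`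
of the quiver `Q̄`. -/
def gSrc (n : ℕ) [NeZero n] (l : ℕ) (x : Fin (l + 1) × ZMod n × ZMod n) :
    ZMod n × ZMod n := (x.2.1, x.2.2)

/-- The target of the basis element `g^l_{p,i,j}`: the vertex `(i+p, j+l−p)`. -/
def gTgt (n : ℕ) [NeZero n] (l : ℕ) (x : Fin (l + 1) × ZMod n × ZMod n) :
    ZMod n × ZMod n := (x.2.1 + ((x.1 : ℕ) : ZMod n), x.2.2 + (l : ZMod n) - ((x.1 : ℕ) : ZMod n))

/-- The source of a basis element of `Λ_q^n`; the basis `B` is indexed by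
`(i,j) ∈ Z_n × Z_n` and a label in `Fin 4`: `0 ↦ e_{ij}`, `1 ↦ a_{ij}`, `2 ↦ b_{ij}`,
`3 ↦ a_{ij} b_{i,j+1}`. -/
def bSrc (n : ℕ) [NeZero n] (x : (ZMod n × ZMod n) × Fin 4) : ZMod n × ZMod n := x.1

/-- The target of a basis element of `Λ_q^n`. -/
def bTgt (n : ℕ) [NeZero n] (x : (ZMod n × ZMod n) × Fin 4) : ZMod n × ZMod n :=
  if x.2 = 0 then x.1 else if x.2 = 1 then (x.1.1, x.1.2 + 1)
  else if x.2 = 2 then (x.1.1 + 1, x.1.2) else (x.1.1 + 1, x.1.2 + 1)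

/-- The set `g^l ∕∕ B` of parallel pairs: pairs of a Koszul basis element `g^l_{p,i,j}`
(`0 ≤ p ≤ l`) and a basis element of `B` having the same source and the same target. -/
def ParPairs (n : ℕ) [NeZero n] (l : ℕ) : Type :=
  {x : (Fin (l + 1) × ZMod n × ZMod n) × ((ZMod n × ZMod n) × Fin 4) //
    gSrc n l x.1 = bSrc n x.2 ∧ gTgt n l x.1 = bTgt n x.2}

/-- `M^l = k(g^l ∕∕ B)`: the `k`-vector space with the parallel pairs as basis. -/
abbrev Mpar (k : Type) [Field k] (n : ℕ) [NeZero n] (l : ℕ) : Type := ParPairs n l →₀ k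

/-- The numbers of `b`-arrows and `a`-arrows in the basis element of `B` with a given label. -/
def labelDegree (c : Fin 4) : ℕ × ℕ := (![0, 0, 1, 1] c, ![0, 1, 0, 1] c)

theorem bTgt_eq (n : ℕ) [NeZero n] (x : (ZMod n × ZMod n) × Fin 4) :
    bTgt n x = (x.1.1 + ((labelDegree x.2).1 : ZMod n), x.1.2 + ((labelDegree x.2).2 : ZMod n)) := by
  obtain ⟨⟨i, j⟩, c⟩ := x
  fin_cases c <;> simp [bTgt, labelDegree]

theorem gTgt_eq_bTgt_iff (n : ℕ) [NeZero n] (l : ℕ) (p : Fin (l + 1)) (i j : ZMod n) (c : Fin 4) :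
    gTgt n l (p, i, j) = bTgt n ((i, j), c) ↔
      (p : ℕ) ≡ (labelDegree c).1 [MOD n] ∧
        l ≡ (labelDegree c).1 + (labelDegree c).2 [MOD n] := by
  rw [bTgt_eq, ← ZMod.natCast_eq_natCast_iff, ← ZMod.natCast_eq_natCast_iff]
  simp only [gTgt, Prod.mk.injEq, add_right_inj, add_sub_assoc, Nat.cast_add]
  refine and_congr_right fun h => ?_
  rw [h, sub_eq_iff_eq_add, add_comm]

/-- A parallel pair amounts to a source vertex, a label and an admissible index `p`. -/
def parPairsEquiv (n : ℕ) [NeZero n] (l : ℕ) :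
    ParPairs n l ≃ (ZMod n × ZMod n) × (Σ c : Fin 4, {p : Fin (l + 1) //
      (p : ℕ) ≡ (labelDegree c).1 [MOD n] ∧
        l ≡ (labelDegree c).1 + (labelDegree c).2 [MOD n]}) where
  toFun x := (x.1.2.1, ⟨x.1.2.2, x.1.1.1, by
    obtain ⟨⟨⟨p, i, j⟩, ⟨v, c⟩⟩, hs, ht⟩ := x
    obtain rfl : (i, j) = v := hs
    exact (gTgt_eq_bTgt_iff n l p i j c).1 ht⟩)
  invFun y := ⟨((y.2.2.1, y.1.1, y.1.2), (y.1, y.2.1)), rfl,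
    (gTgt_eq_bTgt_iff n l y.2.2.1 y.1.1 y.1.2 y.2.1).2 y.2.2.2⟩
  left_inv := by
    rintro ⟨⟨⟨p, i, j⟩, ⟨v, c⟩⟩, hs, ht⟩
    obtain rfl : (i, j) = v := hs
    rfl
  right_inv _ := rfl

instance (n : ℕ) [NeZero n] (l : ℕ) : Finite (ParPairs n l) :=
  Finite.of_equiv _ (parPairsEquiv n l).symm

/-- If `v ≤ l % n`, the residue class of `v` modulo `n` meets `{0, …, l}` in `l / n + 1` points. -/
theorem count_modEq_succ {n l v : ℕ} (hn : 0 < n) (hv : v ≤ l % n) :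
    Nat.count (· ≡ v [MOD n]) (l + 1) = l / n + 1 := by
  have hl := Nat.mod_lt l hn
  have hmod : (l + 1) % n = (l % n + 1) % n := by simp
  rw [Nat.count_modEq_card _ hn, Nat.mod_eq_of_lt (hv.trans_lt hl), Nat.succ_div]
  simp only [Nat.dvd_iff_mod_eq_zero, hmod]
  rcases (Nat.succ_le_of_lt hl).eq_or_lt with h | h
  · simp [show l % n + 1 = n from h]
  · simp [Nat.mod_eq_of_lt (show l % n + 1 < n from h), Nat.lt_succ_of_le hv]

theorem card_modEq_fin (n l v : ℕ) (P : Prop) [Decidable P] :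
    Nat.card {p : Fin (l + 1) // (p : ℕ) ≡ v [MOD n] ∧ P} =
      if P then Nat.count (· ≡ v [MOD n]) (l + 1) else 0 := by
  split_ifs with hP
  · let := Nat.CountSet.fintype (· ≡ v [MOD n]) (l + 1)
    rw [Nat.count_eq_card_fintype, ← Nat.card_eq_fintype_card]
    exact Nat.card_congr
      { toFun p := ⟨p.1, p.1.2, p.2.1⟩
        invFun m := ⟨⟨m.1, m.2.1⟩, m.2.2, hP⟩
        left_inv _ := rfl
        right_inv _ := rfl }
  · simp [hP]

theorem finrank_Mpar (k : Type) [Field k] (n : ℕ) [NeZero n] (l : ℕ) :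
    Module.finrank k (Mpar k n l) = n ^ 2 * ∑ c : Fin 4,
      if l ≡ (labelDegree c).1 + (labelDegree c).2 [MOD n] then
        Nat.count (· ≡ (labelDegree c).1 [MOD n]) (l + 1) else 0 := by
  have := Fintype.ofFinite (ParPairs n l)
  rw [Module.finrank_finsupp_self, ← Nat.card_eq_fintype_card, Nat.card_congr (parPairsEquiv n l),
    Nat.card_prod, Nat.card_prod, Nat.card_zmod, Nat.card_sigma, sq]
  simp only [card_modEq_fin]

/-- **Statement 8.**  For every `l ≥ 0` the dimension `dim_k M^l = dim_k k(g^l ∕∕ B)`, i.e.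
the number of pairs `(g^l_{p,i,j}, x)` with `x ∈ B` parallel to `g^l_{p,i,j}`, equals
`(l₀+1) n²` if `l = l₀ n`, `2(l₀+1) n²` if `l = l₀ n + 1`, `(l₀+1) n²` if `l = l₀ n + 2`,
and `0` otherwise. -/
theorem stmt_8 (k : Type) [Field k] (n : ℕ) [NeZero n] (hn : 3 ≤ n)
    (q : ZMod n → ZMod n → k) (hq : ∀ i j, q i j ≠ 0) :
    ∀ l : ℕ,
      (l % n = 0 → Module.finrank k (Mpar k n l) = (l / n + 1) * n ^ 2) ∧
      (l % n = 1 → Module.finrank k (Mpar k n l) = 2 * (l / n + 1) * n ^ 2) ∧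
      (l % n = 2 → Module.finrank k (Mpar k n l) = (l / n + 1) * n ^ 2) ∧
      (2 < l % n → Module.finrank k (Mpar k n l) = 0) := by
  intro l
  have hn0 : 0 < n := by omega
  have count_zero := count_modEq_succ hn0 (Nat.zero_le (l % n))
  rw [finrank_Mpar]
  simp only [Fin.sum_univ_four, labelDegree, Nat.ModEq, Nat.mod_eq_of_lt (show 0 < n by omega),
    Nat.mod_eq_of_lt (show 1 < n by omega), Nat.mod_eq_of_lt (show 2 < n by omega),
    Matrix.cons_val, Nat.reduceAdd]
  simp only [Nat.ModEq, Nat.mod_eq_of_lt hn0] at count_zero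
  refine ⟨fun h => ?_, fun h => ?_, fun h => ?_, fun h => ?_⟩
  · simp [h, count_zero, mul_comm]
  · have count_one := count_modEq_succ hn0 h.ge
    simp only [Nat.ModEq, Nat.mod_eq_of_lt (show 1 < n by omega)] at count_one
    simp [h, count_zero, count_one]
    ring
  · have count_one := count_modEq_succ hn0 (show 1 ≤ l % n by omega)
    simp only [Nat.ModEq, Nat.mod_eq_of_lt (show 1 < n by omega)] at count_one
    simp [h, count_one, mul_comm]
  · simp [show l % n ≠ 0 by omega, show l % n ≠ 1 by omega, show l % n ≠ 2 by omega]
end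

section
/- Suppose n ≥ 3 and ξ = Π_{i,j∈Z_n} q_{ij} is not a root of unity in k. Then for every integer l₀ ≥ 0: dim_k Im δ^{l₀n+1} = n² − 1 if l₀ = 0 and dim_k Im δ^{l₀n+1} = (l₀+1)n² if l₀ ≥ 1; and dim_k Im δ^{l₀n+2} = n² − 1 if l₀ = 0 and dim_k Im δ^{l₀n+2} = (l₀+1)n² if l₀ ≥ 1. Moreover δ^l = 0 whenever l is not congruent to 1 or 2 modulo n. -/
open FreeAlgebra in
/-- Relations presenting `Λ_q^n = kQ̄/I_q`: the path-algebra relations for `Q̄` together with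
the relations `a_{ij} a_{i,j+1}`, `b_{ij} b_{i+1,j}` and
`a_{ij} b_{i,j+1} + q_{ij} b_{ij} a_{i+1,j}` generating `I_q`. -/
inductive LRel (k : Type) [Field k] (n : ℕ) [NeZero n] (q : ZMod n → ZMod n → k) :
    FreeAlgebra k (GenL n) → FreeAlgebra k (GenL n) → Prop
  | vert (v w : ZMod n × ZMod n) :
      LRel k n q (ι k (GenL.e v) * ι k (GenL.e w)) (if v = w then ι k (GenL.e v) else 0)
  | unit : LRel k n q (∑ v : ZMod n × ZMod n, ι k (GenL.e v)) 1
  | srcA (i j) : LRel k n q (ι k (GenL.e (i, j)) * ι k (GenL.a i j)) (ι k (GenL.a i j))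
  | tgtA (i j) : LRel k n q (ι k (GenL.a i j) * ι k (GenL.e (i, j + 1))) (ι k (GenL.a i j))
  | srcB (i j) : LRel k n q (ι k (GenL.e (i, j)) * ι k (GenL.b i j)) (ι k (GenL.b i j))
  | tgtB (i j) : LRel k n q (ι k (GenL.b i j) * ι k (GenL.e (i + 1, j))) (ι k (GenL.b i j))
  | relAA (i j) : LRel k n q (ι k (GenL.a i j) * ι k (GenL.a i (j + 1))) 0
  | relBB (i j) : LRel k n q (ι k (GenL.b i j) * ι k (GenL.b (i + 1) j)) 0
  | relAB (i j) :
      LRel k n q (ι k (GenL.a i j) * ι k (GenL.b i (j + 1)) +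
        q i j • (ι k (GenL.b i j) * ι k (GenL.a (i + 1) j))) 0

/-- The algebra `Λ_q^n = kQ̄/I_q` (for `q_{ij}` constant, the `Z_n × Z_n`-Galois covering of
the quantized exterior algebra). -/
def Λalg (k : Type) [Field k] (n : ℕ) [NeZero n] (q : ZMod n → ZMod n → k) : Type :=
  RingQuot (LRel k n q)

noncomputable instance (k : Type) [Field k] (n : ℕ) [NeZero n] (q : ZMod n → ZMod n → k) :
    Ring (Λalg k n q) := inferInstanceAs (Ring (RingQuot (LRel k n q)))

noncomputable instance (k : Type) [Field k] (n : ℕ) [NeZero n] (q : ZMod n → ZMod n → k) :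
    Algebra k (Λalg k n q) := inferInstanceAs (Algebra k (RingQuot (LRel k n q)))

/-- The image of a generator in `Λ_q^n`. -/
noncomputable def gL (k : Type) [Field k] (n : ℕ) [NeZero n] (q : ZMod n → ZMod n → k)
    (g : GenL n) : Λalg k n q :=
  (RingQuot.mkAlgHom k (LRel k n q) (FreeAlgebra.ι k g) : RingQuot (LRel k n q))

variable (k : Type) [Field k] (n : ℕ) [NeZero n] (q : ZMod n → ZMod n → k)

/-- The total space carrying the Hochschild cochain complex `(M^•, δ^•)` of `Λ_q^n`:
functions, with finite support, from the index set `{(p,i,j)}` of the canonical Koszul basis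
elements `g^•_{p,i,j}` to `Λ_q^n` (the pair `(g_{p,i,j}, x)` corresponds to the singleton
function `(p,i,j) ↦ x`). -/
abbrev Cco : Type := (ℕ × ZMod n × ZMod n) →₀ Λalg k n q

/-- `M^l ⊆ Cco`: the span of the pairs `(g^l_{p,i,j}, x)` with `0 ≤ p ≤ l` and `x` a uniform
element of `Λ_q^n` parallel to `g^l_{p,i,j}`, i.e. `x ∈ e_{ij} Λ_q^n e_{i+p,j+l−p}`. -/
noncomputable def Mco (l : ℕ) : Submodule k (Cco k n q) :=
  Submodule.span k
    {x | ∃ (p : ℕ) (i j : ZMod n) (y : Λalg k n q), p ≤ l ∧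
      x = Finsupp.single (p, i, j)
        (gL k n q (GenL.e (i, j)) * y *
          gL k n q (GenL.e (i + (p : ZMod n), j + (l : ZMod n) - (p : ZMod n))))}

/-- The differential `δ^l : M^{l−1} → M^l` of the Hochschild cochain complex, given on a pair
`(g^{l−1}_{p,i,j}, x)` by
`δ^l(g^{l−1}_{p,i,j}, x) = (g^l_{p,i,j−1}, a_{i,j−1} x)
 + q_{i−1,j} ⋯ q_{i−1,j+l−p−2} (g^l_{p+1,i−1,j}, b_{i−1,j} x)
 + (−1)^l (g^l_{p+1,i,j}, x b_{i+p,j+l−p−1})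
 + (−1)^l q_{i,j+l−p−1} ⋯ q_{i+p−1,j+l−p−1} (g^l_{p,i,j}, x a_{i+p,j+l−p−1})`. -/
noncomputable def δco (l : ℕ) : Cco k n q →ₗ[k] Cco k n q :=
  Finsupp.lsum k fun x : ℕ × ZMod n × ZMod n =>
    (Finsupp.lsingle (x.1, x.2.1, x.2.2 - 1)).comp
        (LinearMap.mulLeft k (gL k n q (GenL.a x.2.1 (x.2.2 - 1))))
    + (∏ t ∈ Finset.range (l - x.1 - 1), q (x.2.1 - 1) (x.2.2 + (t : ZMod n))) •
        (Finsupp.lsingle (x.1 + 1, x.2.1 - 1, x.2.2)).comp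
          (LinearMap.mulLeft k (gL k n q (GenL.b (x.2.1 - 1) x.2.2)))
    + ((-1 : k) ^ l) •
        (Finsupp.lsingle (x.1 + 1, x.2.1, x.2.2)).comp
          (LinearMap.mulRight k (gL k n q
            (GenL.b (x.2.1 + (x.1 : ZMod n))
              (x.2.2 + (l : ZMod n) - (x.1 : ZMod n) - 1))))
    + ((-1 : k) ^ l *
        ∏ t ∈ Finset.range x.1,
          q (x.2.1 + (t : ZMod n)) (x.2.2 + (l : ZMod n) - (x.1 : ZMod n) - 1)) •
        (Finsupp.lsingle (x.1, x.2.1, x.2.2)).comp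
          (LinearMap.mulRight k (gL k n q
            (GenL.a (x.2.1 + (x.1 : ZMod n))
              (x.2.2 + (l : ZMod n) - (x.1 : ZMod n) - 1))))

namespace TorusKoszul

section Algebra

/-- The quotient map onto `Λ_q^n`. -/
noncomputable def quotMap : FreeAlgebra k (GenL n) →ₐ[k] Λalg k n q :=
  RingQuot.mkAlgHom k (LRel k n q)

lemma quotMap_ι (g : GenL n) : quotMap k n q (FreeAlgebra.ι k g) = gL k n q g := rfl

lemma quotMap_surjective : Function.Surjective (quotMap k n q) :=
  RingQuot.mkAlgHom_surjective k (LRel k n q)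

variable {k n q}

lemma quotMap_eq {x y : FreeAlgebra k (GenL n)} (h : LRel k n q x y) :
    quotMap k n q x = quotMap k n q y :=
  RingQuot.mkAlgHom_rel k h

lemma e_mul_e (v w : ZMod n × ZMod n) :
    gL k n q (.e v) * gL k n q (.e w) = if v = w then gL k n q (.e v) else 0 := by
  have h := quotMap_eq (LRel.vert (k := k) (q := q) v w)
  split_ifs at h ⊢ <;> simpa [quotMap_ι] using h

lemma sum_e : ∑ v : ZMod n × ZMod n, gL k n q (.e v) = 1 := by
  simpa [quotMap_ι] using quotMap_eq (LRel.unit (k := k) (n := n) (q := q))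

lemma e_mul_a_self (i j : ZMod n) : gL k n q (.e (i, j)) * gL k n q (.a i j) = gL k n q (.a i j) := by
  simpa [quotMap_ι] using quotMap_eq (LRel.srcA (k := k) (q := q) i j)

lemma a_mul_e_self (i j : ZMod n) :
    gL k n q (.a i j) * gL k n q (.e (i, j + 1)) = gL k n q (.a i j) := by
  simpa [quotMap_ι] using quotMap_eq (LRel.tgtA (k := k) (q := q) i j)

lemma e_mul_b_self (i j : ZMod n) : gL k n q (.e (i, j)) * gL k n q (.b i j) = gL k n q (.b i j) := by
  simpa [quotMap_ι] using quotMap_eq (LRel.srcB (k := k) (q := q) i j)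

lemma b_mul_e_self (i j : ZMod n) :
    gL k n q (.b i j) * gL k n q (.e (i + 1, j)) = gL k n q (.b i j) := by
  simpa [quotMap_ι] using quotMap_eq (LRel.tgtB (k := k) (q := q) i j)

lemma a_mul_a_self (i j : ZMod n) : gL k n q (.a i j) * gL k n q (.a i (j + 1)) = 0 := by
  simpa [quotMap_ι] using quotMap_eq (LRel.relAA (k := k) (q := q) i j)

lemma b_mul_b_self (i j : ZMod n) : gL k n q (.b i j) * gL k n q (.b (i + 1) j) = 0 := by
  simpa [quotMap_ι] using quotMap_eq (LRel.relBB (k := k) (q := q) i j)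

lemma a_mul_b_add (i j : ZMod n) :
    gL k n q (.a i j) * gL k n q (.b i (j + 1)) +
      q i j • (gL k n q (.b i j) * gL k n q (.a (i + 1) j)) = 0 := by
  simpa [quotMap_ι] using quotMap_eq (LRel.relAB (k := k) (q := q) i j)

lemma q_smul_b_mul_a (i j : ZMod n) :
    q i j • (gL k n q (.b i j) * gL k n q (.a (i + 1) j)) =
      -(gL k n q (.a i j) * gL k n q (.b i (j + 1))) :=
  (neg_eq_of_add_eq_zero_right (a_mul_b_add i j)).symm

lemma b_mul_a_self (hq : ∀ i j, q i j ≠ 0) (i j : ZMod n) :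
    gL k n q (.b i j) * gL k n q (.a (i + 1) j) =
      -(q i j)⁻¹ • (gL k n q (.a i j) * gL k n q (.b i (j + 1))) := by
  rw [neg_smul, ← smul_neg, ← q_smul_b_mul_a, inv_smul_smul₀ (hq i j)]

lemma e_mul_a (v : ZMod n × ZMod n) (i j : ZMod n) :
    gL k n q (.e v) * gL k n q (.a i j) = if v = (i, j) then gL k n q (.a i j) else 0 := by
  rw [← e_mul_a_self, ← mul_assoc, e_mul_e]
  split_ifs with h
  · rw [h]
  · simp

lemma a_mul_e (v : ZMod n × ZMod n) (i j : ZMod n) :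
    gL k n q (.a i j) * gL k n q (.e v) = if (i, j + 1) = v then gL k n q (.a i j) else 0 := by
  rw [← a_mul_e_self, mul_assoc, e_mul_e]
  split_ifs with h <;> simp

lemma e_mul_b (v : ZMod n × ZMod n) (i j : ZMod n) :
    gL k n q (.e v) * gL k n q (.b i j) = if v = (i, j) then gL k n q (.b i j) else 0 := by
  rw [← e_mul_b_self, ← mul_assoc, e_mul_e]
  split_ifs with h
  · rw [h]
  · simp

lemma b_mul_e (v : ZMod n × ZMod n) (i j : ZMod n) :
    gL k n q (.b i j) * gL k n q (.e v) = if (i + 1, j) = v then gL k n q (.b i j) else 0 := by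
  rw [← b_mul_e_self, mul_assoc, e_mul_e]
  split_ifs with h <;> simp

lemma a_mul_a (i j i' j' : ZMod n) : gL k n q (.a i j) * gL k n q (.a i' j') = 0 := by
  rw [← a_mul_e_self, mul_assoc, e_mul_a]
  split_ifs with h
  · cases h; exact a_mul_a_self i j
  · simp

lemma b_mul_b (i j i' j' : ZMod n) : gL k n q (.b i j) * gL k n q (.b i' j') = 0 := by
  rw [← b_mul_e_self, mul_assoc, e_mul_b]
  split_ifs with h
  · cases h; exact b_mul_b_self i j
  · simp

lemma a_mul_b_of_ne {i j i' j' : ZMod n} (h : (i, j + 1) ≠ (i', j')) :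
    gL k n q (.a i j) * gL k n q (.b i' j') = 0 := by
  rw [← a_mul_e_self, mul_assoc, e_mul_b, if_neg h, mul_zero]

lemma b_mul_a_of_ne {i j i' j' : ZMod n} (h : (i + 1, j) ≠ (i', j')) :
    gL k n q (.b i j) * gL k n q (.a i' j') = 0 := by
  rw [← b_mul_e_self, mul_assoc, e_mul_a, if_neg h, mul_zero]

lemma a_mul_ab (i j i' j' : ZMod n) (y : Λalg k n q) :
    gL k n q (.a i j) * (gL k n q (.a i' j') * y) = 0 := by
  rw [← mul_assoc, a_mul_a, zero_mul]

lemma b_mul_ab (hq : ∀ i j, q i j ≠ 0) (i j i' j' i'' j'' : ZMod n) :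
    gL k n q (.b i j) * (gL k n q (.a i' j') * gL k n q (.b i'' j'')) = 0 := by
  rw [← mul_assoc]
  by_cases h : (i + 1, j) = (i', j')
  · cases h
    rw [b_mul_a_self hq, smul_mul_assoc, mul_assoc, b_mul_b, mul_zero, smul_zero]
  · rw [b_mul_a_of_ne h, zero_mul]

lemma ab_mul_b (i j i' j' : ZMod n) (y : Λalg k n q) :
    y * gL k n q (.b i j) * gL k n q (.b i' j') = 0 := by
  rw [mul_assoc, b_mul_b, mul_zero]

lemma ab_mul_a (hq : ∀ i j, q i j ≠ 0) (i j i' j' i'' j'' : ZMod n) :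
    gL k n q (.a i j) * gL k n q (.b i' j') * gL k n q (.a i'' j'') = 0 := by
  rw [mul_assoc]
  by_cases h : (i' + 1, j') = (i'', j'')
  · cases h
    rw [b_mul_a_self hq, mul_smul_comm, ← mul_assoc, a_mul_a, zero_mul, smul_zero]
  · rw [b_mul_a_of_ne h, mul_zero]

variable (k n q) in
/-- The basis `B` of `Λ_q^n`, as a set. -/
def basisSet : Set (Λalg k n q) :=
  {x | ∃ i j : ZMod n, x = gL k n q (.e (i, j)) ∨ x = gL k n q (.a i j) ∨ x = gL k n q (.b i j) ∨
    x = gL k n q (.a i j) * gL k n q (.b i (j + 1))}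

lemma gL_mul_mem_span (hq : ∀ i j, q i j ≠ 0) (g : GenL n) {x : Λalg k n q}
    (hx : x ∈ Submodule.span k (basisSet k n q)) :
    gL k n q g * x ∈ Submodule.span k (basisSet k n q) := by
  have mem : ∀ {y}, y ∈ basisSet k n q → y ∈ Submodule.span k (basisSet k n q) :=
    fun h => Submodule.subset_span h
  induction hx using Submodule.span_induction with
  | zero => simp
  | add x y _ _ hx hy => rw [mul_add]; exact add_mem hx hy
  | smul c x _ hx => rw [mul_smul_comm]; exact Submodule.smul_mem _ _ hx
  | mem x hx =>
    obtain ⟨i, j, rfl | rfl | rfl | rfl⟩ := hx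
    · rcases g with v | ⟨i', j'⟩ | ⟨i', j'⟩
      · rw [e_mul_e]; split_ifs with h
        · exact mem ⟨i, j, .inl (by rw [h])⟩
        · exact zero_mem _
      · rw [a_mul_e]; split_ifs
        · exact mem ⟨i', j', .inr (.inl rfl)⟩
        · exact zero_mem _
      · rw [b_mul_e]; split_ifs
        · exact mem ⟨i', j', .inr (.inr (.inl rfl))⟩
        · exact zero_mem _
    · rcases g with v | ⟨i', j'⟩ | ⟨i', j'⟩
      · rw [e_mul_a]; split_ifs with h
        · exact mem ⟨i, j, .inr (.inl rfl)⟩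
        · exact zero_mem _
      · rw [a_mul_a]; exact zero_mem _
      · by_cases h : (i' + 1, j') = (i, j)
        · cases h
          rw [b_mul_a_self hq]
          exact Submodule.smul_mem _ _ (mem ⟨i', j, .inr (.inr (.inr rfl))⟩)
        · rw [b_mul_a_of_ne h]; exact zero_mem _
    · rcases g with v | ⟨i', j'⟩ | ⟨i', j'⟩
      · rw [e_mul_b]; split_ifs with h
        · exact mem ⟨i, j, .inr (.inr (.inl rfl))⟩
        · exact zero_mem _
      · by_cases h : (i', j' + 1) = (i, j)
        · cases h
          exact mem ⟨i, j', .inr (.inr (.inr rfl))⟩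
        · rw [a_mul_b_of_ne h]; exact zero_mem _
      · rw [b_mul_b]; exact zero_mem _
    · rcases g with v | ⟨i', j'⟩ | ⟨i', j'⟩
      · rw [← mul_assoc, e_mul_a]; split_ifs with h
        · exact mem ⟨i, j, .inr (.inr (.inr rfl))⟩
        · rw [zero_mul]; exact zero_mem _
      · rw [a_mul_ab]; exact zero_mem _
      · rw [b_mul_ab hq]; exact zero_mem _

lemma span_basisSet (hq : ∀ i j, q i j ≠ 0) : Submodule.span k (basisSet k n q) = ⊤ := by
  have key : ∀ z : FreeAlgebra k (GenL n), ∀ x ∈ Submodule.span k (basisSet k n q),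
      quotMap k n q z * x ∈ Submodule.span k (basisSet k n q) := by
    intro z
    induction z using FreeAlgebra.induction with
    | grade0 r =>
      intro x hx
      rw [AlgHom.commutes, ← Algebra.smul_def]
      exact Submodule.smul_mem _ _ hx
    | grade1 g => exact fun x hx => gL_mul_mem_span hq g hx
    | mul a b ha hb =>
      intro x hx
      rw [map_mul, mul_assoc]
      exact ha _ (hb _ hx)
    | add a b ha hb =>
      intro x hx
      rw [map_add, add_mul]
      exact add_mem (ha _ hx) (hb _ hx)
  have one_mem : (1 : Λalg k n q) ∈ Submodule.span k (basisSet k n q) := by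
    rw [← sum_e]
    exact Submodule.sum_mem _ fun v _ => Submodule.subset_span ⟨v.1, v.2, .inl rfl⟩
  refine eq_top_iff.mpr fun y _ => ?_
  obtain ⟨z, rfl⟩ := quotMap_surjective k n q y
  simpa using key z 1 one_mem

variable (k n q) in
/-- The elements of `B` that are parallel to a path from `(i, j)` to `(i + r, j + s)`. -/
def parallelSet (i j r s : ZMod n) : Set (Λalg k n q) :=
  {x | (r = 0 ∧ s = 0 ∧ x = gL k n q (.e (i, j))) ∨ (r = 0 ∧ s = 1 ∧ x = gL k n q (.a i j)) ∨
    (r = 1 ∧ s = 0 ∧ x = gL k n q (.b i j)) ∨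
    (r = 1 ∧ s = 1 ∧ x = gL k n q (.a i j) * gL k n q (.b i (j + 1)))}

lemma e_mul_mul_e_mem (hq : ∀ i j, q i j ≠ 0) (i j r s : ZMod n) (y : Λalg k n q) :
    gL k n q (.e (i, j)) * y * gL k n q (.e (i + r, j + s)) ∈
      Submodule.span k (parallelSet k n q i j r s) := by
  have hy : y ∈ Submodule.span k (basisSet k n q) := by rw [span_basisSet hq]; trivial
  induction hy using Submodule.span_induction with
  | zero => simp
  | add x y _ _ hx hy => rw [mul_add, add_mul]; exact add_mem hx hy
  | smul c x _ hx => rw [mul_smul_comm, smul_mul_assoc]; exact Submodule.smul_mem _ _ hx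
  | mem x hx =>
    obtain ⟨i', j', rfl | rfl | rfl | rfl⟩ := hx
    · rw [e_mul_e]; split_ifs with h
      · cases h
        rw [e_mul_e]; split_ifs with h
        · exact Submodule.subset_span (.inl (by simpa using h))
        · exact zero_mem _
      · rw [zero_mul]; exact zero_mem _
    · rw [e_mul_a]; split_ifs with h
      · cases h
        rw [a_mul_e]; split_ifs with h
        · exact Submodule.subset_span (.inr (.inl (by simpa [eq_comm] using h)))
        · exact zero_mem _
      · rw [zero_mul]; exact zero_mem _
    · rw [e_mul_b]; split_ifs with h
      · cases h
        rw [b_mul_e]; split_ifs with h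
        · exact Submodule.subset_span (.inr (.inr (.inl (by simpa [eq_comm] using h))))
        · exact zero_mem _
      · rw [zero_mul]; exact zero_mem _
    · rw [← mul_assoc, e_mul_a]; split_ifs with h
      · cases h
        rw [mul_assoc, b_mul_e]; split_ifs with h
        · exact Submodule.subset_span (.inr (.inr (.inr (by simpa [eq_comm] using h))))
        · rw [mul_zero]; exact zero_mem _
      · rw [zero_mul, zero_mul]; exact zero_mem _

lemma eq_e_mul_mul_e {i j r s : ZMod n} {x : Λalg k n q} (hx : x ∈ parallelSet k n q i j r s) :
    gL k n q (.e (i, j)) * x * gL k n q (.e (i + r, j + s)) = x := by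
  obtain ⟨rfl, rfl, rfl⟩ | ⟨rfl, rfl, rfl⟩ | ⟨rfl, rfl, rfl⟩ | ⟨rfl, rfl, rfl⟩ := hx
  · simp [e_mul_e]
  · simp [e_mul_a, a_mul_e]
  · simp [e_mul_b, b_mul_e]
  · rw [← mul_assoc, e_mul_a_self, mul_assoc, b_mul_e_self]

/-- The representation of `Λ_q^n` on `k^{Z_n × Z_n}` afforded by the projective module at the
vertex `(i₀, j₀)`, with the vertices outside its support acting by themselves. -/
noncomputable def squareRepGen (q : ZMod n → ZMod n → k) (i₀ j₀ : ZMod n) :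
    GenL n → Matrix (ZMod n × ZMod n) (ZMod n × ZMod n) k
  | .e v => Matrix.single v v 1
  | .a i j => Matrix.single (i, j) (i, j + 1)
      (if j = j₀ then if i = i₀ then 1 else if i = i₀ + 1 then -(q i₀ j₀)⁻¹ else 0 else 0)
  | .b i j => Matrix.single (i, j) (i + 1, j)
      (if i = i₀ then if j = j₀ then 1 else if j = j₀ + 1 then 1 else 0 else 0)

lemma zmod_one_ne_zero {m : ℕ} (hm : 3 ≤ m) : (1 : ZMod m) ≠ 0 := by
  have : Fact (1 < m) := ⟨by omega⟩
  exact one_ne_zero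

lemma zmod_two_ne_zero {m : ℕ} (hm : 3 ≤ m) : (2 : ZMod m) ≠ 0 := by
  intro h
  have h' : ((2 : ℕ) : ZMod m) = 0 := by exact_mod_cast h
  exact absurd (Nat.le_of_dvd (by norm_num) ((ZMod.natCast_eq_zero_iff _ _).mp h')) (by omega)

lemma squareRepGen_rel (hn : 3 ≤ n) (hq : ∀ i j, q i j ≠ 0) (i₀ j₀ : ZMod n)
    ⦃x y : FreeAlgebra k (GenL n)⦄ (h : LRel k n q x y) :
    FreeAlgebra.lift k (squareRepGen q i₀ j₀) x = FreeAlgebra.lift k (squareRepGen q i₀ j₀) y := by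
  have h1 : ∀ x : ZMod n, x + 1 ≠ x := by simpa using zmod_one_ne_zero hn
  have h2 : ∀ x : ZMod n, x + 1 + 1 ≠ x := fun x h =>
    zmod_two_ne_zero hn (by linear_combination h)
  have h3 : ∀ x y : ZMod n, x + 1 = y + 1 → x = y := fun x y => add_right_cancel
  induction h with
  | vert v w =>
    by_cases h : v = w
    · simp [squareRepGen, h]
    · simp [squareRepGen, h, Matrix.single_mul_single_of_ne]
  | unit => simpa [squareRepGen] using Matrix.sum_single_one
  | srcA | tgtA | srcB | tgtB => simp [squareRepGen]
  | relAA i j =>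
    simp only [map_mul, FreeAlgebra.lift_ι_apply, squareRepGen, Matrix.single_mul_single_same,
      map_zero]
    refine (congrArg _ ?_).trans (Matrix.single_zero _ _)
    grind
  | relBB i j =>
    simp only [map_mul, FreeAlgebra.lift_ι_apply, squareRepGen, Matrix.single_mul_single_same,
      map_zero]
    refine (congrArg _ ?_).trans (Matrix.single_zero _ _)
    grind
  | relAB i j =>
    simp only [map_mul, map_add, map_smul, FreeAlgebra.lift_ι_apply, squareRepGen,
      Matrix.single_mul_single_same, map_zero, Matrix.smul_single, ← Matrix.single_add]
    refine (congrArg _ ?_).trans (Matrix.single_zero _ _)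
    have := hq i₀ j₀
    simp only [smul_eq_mul, mul_ite, mul_one, mul_zero]
    split_ifs <;> grind

lemma ab_ne_zero (hn : 3 ≤ n) (hq : ∀ i j, q i j ≠ 0) (i j : ZMod n) :
    gL k n q (.a i j) * gL k n q (.b i (j + 1)) ≠ 0 := by
  intro h
  have h' := congrArg
    (RingQuot.liftAlgHom k ⟨FreeAlgebra.lift k (squareRepGen q i j), squareRepGen_rel hn hq i j⟩)
    (show quotMap k n q (.ι k (.a i j) * .ι k (.b i (j + 1))) = 0 by
      rw [map_mul]; exact h)
  erw [RingQuot.liftAlgHom_mkAlgHom_apply] at h'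
  erw [map_zero] at h'
  have h'' := congrFun (congrFun h' (i, j)) (i + 1, j + 1)
  simp [squareRepGen] at h''

lemma a_ne_zero (hn : 3 ≤ n) (hq : ∀ i j, q i j ≠ 0) (i j : ZMod n) : gL k n q (.a i j) ≠ 0 :=
  left_ne_zero_of_mul (ab_ne_zero hn hq i j)

lemma b_ne_zero (hn : 3 ≤ n) (hq : ∀ i j, q i j ≠ 0) (i j : ZMod n) : gL k n q (.b i j) ≠ 0 := by
  have h := right_ne_zero_of_mul (ab_ne_zero hn hq i (j - 1))
  rwa [sub_add_cancel] at h

end Algebra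

section CyclicDifferences

variable {k n}

lemma prod_range_add_cast (F : ZMod n → k) (i : ZMod n) :
    ∏ t ∈ Finset.range n, F (i + (t : ZMod n)) = ∏ x, F x := by
  refine Finset.prod_nbij' (fun t => i + (t : ZMod n)) (fun x => (x - i).val) (by simp)
    (fun x _ => Finset.mem_range.mpr (ZMod.val_lt _)) ?_ (by simp) (by simp)
  intro t ht
  simpa using ZMod.val_cast_of_lt (Finset.mem_range.mp ht)

lemma prod_range_mul_add_cast (F : ZMod n → k) (i : ZMod n) (m : ℕ) :
    ∏ t ∈ Finset.range (m * n), F (i + (t : ZMod n)) = (∏ x, F x) ^ m := by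
  induction m with
  | zero => simp
  | succ m ih =>
    rw [Nat.succ_mul, Finset.prod_range_add, ih, pow_succ, ← prod_range_add_cast F i]
    simp

lemma prod_mul_eq_prod_mul {u w g : ZMod n → k} (h : ∀ i, u i * g (i + 1) = w i * g i)
    (i : ZMod n) : (∏ x, u x) * g i = (∏ x, w x) * g i := by
  have key : ∀ m : ℕ, (∏ t ∈ Finset.range m, u (i + (t : ZMod n))) * g (i + (m : ZMod n)) =
      (∏ t ∈ Finset.range m, w (i + (t : ZMod n))) * g i := by
    intro m
    induction m with
    | zero => simp
    | succ m ih =>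
      rw [Finset.prod_range_succ, Finset.prod_range_succ, Nat.cast_succ, ← add_assoc]
      linear_combination (∏ t ∈ Finset.range m, u (i + (t : ZMod n))) * h (i + m) +
        w (i + m) * ih
  have := key n
  rwa [prod_range_add_cast, prod_range_add_cast, ZMod.natCast_self, add_zero] at this

lemma eq_zero_of_apply_add_one {ε : k} (hε : ε ^ 2 = 1) {c g : ZMod n → k}
    (hc : (∏ x, c x) ^ 2 ≠ 1) (h : ∀ j, g (j + 1) = ε * c j * g j) (j : ZMod n) : g j = 0 := by
  by_contra hg
  have := mul_right_cancel₀ hg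
    (prod_mul_eq_prod_mul (u := fun _ => 1) (fun i => (one_mul _).trans (h i)) j)
  rw [Finset.prod_mul_distrib, Finset.prod_const_one, Finset.prod_const] at this
  have h2 := congrArg (· ^ 2) this
  simp only [one_pow, mul_pow, ← pow_mul, mul_comm _ 2] at h2
  rw [pow_mul, hε, one_pow, one_mul] at h2
  exact hc h2.symm

lemma eq_zero_of_mul_apply_add_one {ε : k} (hε : ε ^ 2 = 1) {r g : ZMod n → k}
    (hr : (∏ x, r x) ^ 2 ≠ 1) (h : ∀ i, r i * g (i + 1) = ε * g i) (i : ZMod n) : g i = 0 := by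
  by_contra hg
  have := mul_right_cancel₀ hg (prod_mul_eq_prod_mul h i)
  rw [Finset.prod_const] at this
  apply hr
  rw [this, ← pow_mul, mul_comm, pow_mul, hε, one_pow]

lemma apply_eq_apply_zero {X : Type*} {g : ZMod n → X} (h : ∀ i, g (i + 1) = g i) (i : ZMod n) :
    g i = g 0 := by
  have key : ∀ m : ℕ, g (m : ZMod n) = g 0 := by
    intro m
    induction m with
    | zero => simp
    | succ m ih => rw [Nat.cast_succ, h, ih]
  simpa using key i.val

variable {m : ℕ}

/-- The translation of `Z_n × Z_n` in the first direction. -/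
def shiftFst : Fin m × ZMod n × ZMod n ≃ Fin m × ZMod n × ZMod n :=
  (Equiv.refl _).prodCongr ((Equiv.addRight 1).prodCongr (Equiv.refl _))

/-- The translation of `Z_n × Z_n` in the second direction. -/
def shiftSnd : Fin m × ZMod n × ZMod n ≃ Fin m × ZMod n × ZMod n :=
  (Equiv.refl _).prodCongr ((Equiv.refl _).prodCongr (Equiv.addRight 1))

lemma shiftFst_apply {n : ℕ} (x : Fin m × ZMod n × ZMod n) :
    shiftFst x = (x.1, x.2.1 + 1, x.2.2) := rfl

lemma shiftSnd_apply {n : ℕ} (x : Fin m × ZMod n × ZMod n) :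
    shiftSnd x = (x.1, x.2.1, x.2.2 + 1) := rfl

/-- The twisted difference operator whose components are the coefficients of `δ` on the pairs
`(g, e)` at the pairs `(g, a)` and `(g, b)`. -/
def gradMap (ε : k) (r c : Fin m → ZMod n → k) :
    (Fin m × ZMod n × ZMod n → k) →ₗ[k]
      (Fin m × ZMod n × ZMod n ⊕ Fin m × ZMod n × ZMod n → k) where
  toFun f := Sum.elim
    (fun x => f (x.1, x.2.1, x.2.2 + 1) + ε * c x.1 x.2.2 * f x)
    (fun x => r x.1 x.2.1 * f (x.1, x.2.1 + 1, x.2.2) + ε * f x)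
  map_add' f g := by
    funext x; rcases x with x | x <;> simp <;> ring
  map_smul' t f := by
    funext x; rcases x with x | x <;> simp <;> ring

/-- The twisted difference operator whose components are the coefficients of `δ` on the pairs
`(g, a)` and `(g, b)` at the pairs `(g, ab)`. -/
def divMap (ε : k) (r c : Fin m → ZMod n → k) :
    (Fin m × ZMod n × ZMod n ⊕ Fin m × ZMod n × ZMod n → k) →ₗ[k]
      (Fin m × ZMod n × ZMod n → k) where
  toFun h x := ε * h (.inl x) - r x.1 x.2.1 * h (.inl (x.1, x.2.1 + 1, x.2.2)) +
    (h (.inr (x.1, x.2.1, x.2.2 + 1)) - ε * c x.1 x.2.2 * h (.inr x))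
  map_add' f g := by funext x; simp; ring
  map_smul' t f := by funext x; simp; ring

lemma gradMap_injective {ε : k} (hε : ε ^ 2 = 1) {r c : Fin m → ZMod n → k}
    (h : ∀ s, (∏ x, c s x) ^ 2 ≠ 1 ∨ (∏ x, r s x) ^ 2 ≠ 1) :
    Function.Injective (gradMap ε r c) := by
  rw [injective_iff_map_eq_zero]
  intro f hf
  funext ⟨s, i, j⟩
  have hε' : (-ε) ^ 2 = 1 := by rw [neg_sq, hε]
  rcases h s with hs | hs
  · refine eq_zero_of_apply_add_one (g := fun j => f (s, i, j)) hε' hs (fun j => ?_) j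
    have := congrFun hf (.inl (s, i, j))
    simp only [gradMap, LinearMap.coe_mk, AddHom.coe_mk, Sum.elim_inl, Pi.zero_apply] at this
    linear_combination this
  · refine eq_zero_of_mul_apply_add_one (g := fun i => f (s, i, j)) hε' hs (fun i => ?_) i
    have := congrFun hf (.inr (s, i, j))
    simp only [gradMap, LinearMap.coe_mk, AddHom.coe_mk, Sum.elim_inr, Pi.zero_apply] at this
    linear_combination this

open Classical in
lemma divMap_surjective {ε : k} (hε : ε ^ 2 = 1) {r c : Fin m → ZMod n → k}
    (h : ∀ s, (∏ x, c s x) ^ 2 ≠ 1 ∨ (∏ x, r s x) ^ 2 ≠ 1) :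
    Function.Surjective (divMap ε r c) := by
  let P : Fin m → Prop := fun s => (∏ x, c s x) ^ 2 ≠ 1
  let L : (Fin m × ZMod n × ZMod n → k) →ₗ[k]
      (Fin m × ZMod n × ZMod n ⊕ Fin m × ZMod n × ZMod n → k) :=
    { toFun := fun f => Sum.elim (fun x => if P x.1 then 0 else f x)
        (fun x => if P x.1 then f x else 0)
      map_add' := fun f g => by
        funext x; rcases x with x | x <;> by_cases hx : P x.1 <;> simp [hx]
      map_smul' := fun t f => by
        funext x; rcases x with x | x <;> by_cases hx : P x.1 <;> simp [hx] }
  suffices hinj : Function.Injective (divMap ε r c ∘ₗ L) by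
    exact Function.Surjective.of_comp (g := L) (LinearMap.injective_iff_surjective.mp hinj)
  rw [injective_iff_map_eq_zero]
  intro f hf
  funext ⟨s, i, j⟩
  by_cases hs : P s
  · refine eq_zero_of_apply_add_one (g := fun j => f (s, i, j)) hε hs (fun j => ?_) j
    have := congrFun hf (s, i, j)
    simp [divMap, L, hs] at this
    linear_combination this
  · refine eq_zero_of_mul_apply_add_one (g := fun i => f (s, i, j)) hε
      ((h s).resolve_left hs) (fun i => ?_) i
    have := congrFun hf (s, i, j)
    simp [divMap, L, hs] at this
    linear_combination -this

lemma finrank_range_gradMap_one :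
    Module.finrank k (LinearMap.range (gradMap (-1) (fun _ _ => 1) (fun _ _ => 1) :
      (Fin 1 × ZMod n × ZMod n → k) →ₗ[k] _)) = n ^ 2 - 1 := by
  set G : (Fin 1 × ZMod n × ZMod n → k) →ₗ[k] _ := gradMap (-1) (fun _ _ => 1) (fun _ _ => 1)
    with hG
  have hker : LinearMap.ker G = Submodule.span k {1} := by
    refine le_antisymm (fun f hf => ?_) ?_
    · refine Submodule.mem_span_singleton.mpr ⟨f (0, 0, 0), funext fun ⟨s, i, j⟩ => ?_⟩
      have h1 : ∀ j, f (0, i, j) = f (0, i, 0) := apply_eq_apply_zero fun j => by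
        have := congrFun hf (.inl (0, i, j))
        simp [hG, gradMap] at this
        linear_combination this
      have h2 : ∀ i, f (0, i, 0) = f (0, 0, 0) :=
        apply_eq_apply_zero (g := fun i => f (0, i, 0)) fun i => by
          have := congrFun hf (.inr (0, i, 0))
          simp [hG, gradMap] at this
          linear_combination this
      rw [Subsingleton.elim s 0, h1 j, h2 i]
      simp
    · rw [Submodule.span_singleton_le_iff_mem, LinearMap.mem_ker]
      funext x; rcases x with x | x <;> simp [hG, gradMap]
  have h := G.finrank_range_add_finrank_ker
  rw [hker, finrank_span_singleton one_ne_zero] at h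
  simp only [Module.finrank_fintype_fun_eq_card, Fintype.card_prod, Fintype.card_fin, one_mul,
    ZMod.card, ← sq] at h
  omega

lemma finrank_range_divMap_one :
    Module.finrank k (LinearMap.range (divMap 1 (fun _ _ => 1) (fun _ _ => 1) :
      (Fin 1 × ZMod n × ZMod n ⊕ Fin 1 × ZMod n × ZMod n → k) →ₗ[k] _)) = n ^ 2 - 1 := by
  set G : (Fin 1 × ZMod n × ZMod n ⊕ Fin 1 × ZMod n × ZMod n → k) →ₗ[k] _ :=
    divMap 1 (fun _ _ => 1) (fun _ _ => 1) with hG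
  let S : Module.Dual k (Fin 1 × ZMod n × ZMod n → k) := ∑ x, LinearMap.proj x
  have hS : S ≠ 0 := fun h => by
    have := LinearMap.congr_fun h (Pi.single (0, 0, 0) 1)
    simp [S] at this
  have hker : LinearMap.ker G.dualMap = Submodule.span k {S} := by
    refine le_antisymm (fun φ hφ => ?_) ?_
    · have h0 : ∀ h, φ (G h) = 0 := fun h => LinearMap.congr_fun hφ h
      have step1 : ∀ i j, φ (Pi.single (0, i, j + 1) 1) = φ (Pi.single (0, i, j) 1) := by
        intro i j
        have hs : G (Pi.single (.inr (0, i, j + 1)) 1) =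
            Pi.single (0, i, j) 1 - Pi.single (0, i, j + 1) 1 := by
          funext ⟨s, x, y⟩
          simp [hG, divMap, Pi.single_apply, Subsingleton.elim s 0]
        have := h0 (Pi.single (.inr (0, i, j + 1)) 1)
        rw [hs, map_sub] at this
        exact (sub_eq_zero.mp this).symm
      have step2 : ∀ i j, φ (Pi.single (0, i + 1, j) 1) = φ (Pi.single (0, i, j) 1) := by
        intro i j
        have hs : G (Pi.single (.inl (0, i + 1, j)) 1) =
            Pi.single (0, i + 1, j) 1 - Pi.single (0, i, j) 1 := by
          funext ⟨s, x, y⟩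
          simp [hG, divMap, Pi.single_apply, Subsingleton.elim s 0]
        have := h0 (Pi.single (.inl (0, i + 1, j)) 1)
        rw [hs, map_sub] at this
        exact sub_eq_zero.mp this
      refine Submodule.mem_span_singleton.mpr ⟨φ (Pi.single (0, 0, 0) 1), ?_⟩
      refine LinearMap.pi_ext' fun ⟨s, i, j⟩ => LinearMap.ext_ring ?_
      rw [Subsingleton.elim s 0]
      have e1 := apply_eq_apply_zero (g := fun j => φ (Pi.single (0, i, j) 1)) (step1 i) j
      have e2 := apply_eq_apply_zero (g := fun i => φ (Pi.single (0, i, 0) 1)) (step2 · 0) i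
      have hS : S (Pi.single (0, i, j) 1) = 1 := by simp [S]
      simpa [hS] using (e1.trans e2).symm
    · rw [Submodule.span_singleton_le_iff_mem, LinearMap.mem_ker]
      refine LinearMap.ext fun h => ?_
      have h1 := (shiftFst (n := n) (m := 1)).sum_comp (fun x => h (.inl x))
      have h2 := (shiftSnd (n := n) (m := 1)).sum_comp (fun x => h (.inr x))
      simp only [shiftFst_apply, shiftSnd_apply] at h1 h2
      simp [S, hG, divMap, Finset.sum_add_distrib, Finset.sum_sub_distrib, h1, h2]
  have h := G.dualMap.finrank_range_add_finrank_ker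
  rw [hker, finrank_span_singleton hS, LinearMap.finrank_range_dualMap_eq_finrank_range,
    Subspace.dual_finrank_eq] at h
  simp only [Module.finrank_fintype_fun_eq_card, Fintype.card_prod, Fintype.card_fin, one_mul,
    ZMod.card, ← sq] at h
  omega

end CyclicDifferences

section Cochains

variable {k n q}

lemma δco_single (l p : ℕ) (i j : ZMod n) (y : Λalg k n q) :
    δco k n q l (Finsupp.single (p, i, j) y) =
      Finsupp.single (p, i, j - 1) (gL k n q (.a i (j - 1)) * y) +
      (∏ t ∈ Finset.range (l - p - 1), q (i - 1) (j + (t : ZMod n))) •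
        Finsupp.single (p + 1, i - 1, j) (gL k n q (.b (i - 1) j) * y) +
      ((-1 : k) ^ l) •
        Finsupp.single (p + 1, i, j)
          (y * gL k n q (.b (i + (p : ZMod n)) (j + (l : ZMod n) - (p : ZMod n) - 1))) +
      ((-1 : k) ^ l *
        ∏ t ∈ Finset.range p,
          q (i + (t : ZMod n)) (j + (l : ZMod n) - (p : ZMod n) - 1)) •
        Finsupp.single (p, i, j)
          (y * gL k n q (.a (i + (p : ZMod n)) (j + (l : ZMod n) - (p : ZMod n) - 1))) := by
  simp [δco]

variable (k n q) in
/-- The pairs spanning `M^l`. -/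
def pairSet (l : ℕ) : Set (Cco k n q) :=
  {x | ∃ (p : ℕ) (i j : ZMod n) (y : Λalg k n q), p ≤ l ∧
    y ∈ parallelSet k n q i j p ((l : ZMod n) - p) ∧ x = Finsupp.single (p, i, j) y}

lemma Mco_eq_span (hq : ∀ i j, q i j ≠ 0) (l : ℕ) :
    Mco k n q l = Submodule.span k (pairSet k n q l) := by
  refine le_antisymm (Submodule.span_le.mpr ?_) (Submodule.span_mono ?_)
  · rintro _ ⟨p, i, j, y, hp, rfl⟩
    have hy := e_mul_mul_e_mem hq i j p ((l : ZMod n) - p) y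
    rw [← add_sub_assoc] at hy
    refine (Submodule.map_le_iff_le_comap.mp ?_ : _ ≤ (Submodule.span k (pairSet k n q l)).comap
      (Finsupp.lsingle (p, i, j))) hy
    rw [Submodule.map_span, Submodule.span_le]
    rintro _ ⟨z, hz, rfl⟩
    exact Submodule.subset_span ⟨p, i, j, z, hp, hz, rfl⟩
  · rintro _ ⟨p, i, j, y, hp, hy, rfl⟩
    refine ⟨p, i, j, y, hp, ?_⟩
    rw [add_sub_assoc, eq_e_mul_mul_e hy]

variable (k n q) in
/-- The pairs `(g_{sn,i,j}, e_{ij})` with `s < m`. -/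
noncomputable def pairE (m : ℕ) (x : Fin m × ZMod n × ZMod n) : Cco k n q :=
  Finsupp.single (x.1 * n, x.2.1, x.2.2) (gL k n q (.e x.2))

variable (k n q) in
/-- The pairs `(g_{sn,i,j}, a_{ij})` with `s < m`. -/
noncomputable def pairA (m : ℕ) (x : Fin m × ZMod n × ZMod n) : Cco k n q :=
  Finsupp.single (x.1 * n, x.2.1, x.2.2) (gL k n q (.a x.2.1 x.2.2))

variable (k n q) in
/-- The pairs `(g_{sn+1,i,j}, b_{ij})` with `s < m`. -/
noncomputable def pairB (m : ℕ) (x : Fin m × ZMod n × ZMod n) : Cco k n q :=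
  Finsupp.single (x.1 * n + 1, x.2.1, x.2.2) (gL k n q (.b x.2.1 x.2.2))

variable (k n q) in
/-- The pairs `(g_{sn+1,i,j}, a_{ij}b_{i,j+1})` with `s < m`. -/
noncomputable def pairAB (m : ℕ) (x : Fin m × ZMod n × ZMod n) : Cco k n q :=
  Finsupp.single (x.1 * n + 1, x.2.1, x.2.2)
    (gL k n q (.a x.2.1 x.2.2) * gL k n q (.b x.2.1 (x.2.2 + 1)))

lemma exists_eq_mul_of_cast_eq_zero {n l₀ p : ℕ} (hp : p < (l₀ + 1) * n) (h : (p : ZMod n) = 0) :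
    ∃ s : Fin (l₀ + 1), p = s * n := by
  obtain ⟨s, rfl⟩ := (ZMod.natCast_eq_zero_iff _ _).mp h
  rw [mul_comm] at hp
  exact ⟨⟨s, lt_of_mul_lt_mul_right hp (Nat.zero_le n)⟩, mul_comm _ _⟩

lemma exists_eq_mul_add_one_of_cast_eq_one {n l₀ p : ℕ} (hn : 3 ≤ n)
    (hp : p ≤ (l₀ + 1) * n) (h : (p : ZMod n) = 1) : ∃ s : Fin (l₀ + 1), p = s * n + 1 := by
  rcases p with _ | p
  · exact absurd h (by simpa using (zmod_one_ne_zero hn).symm)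
  · obtain ⟨s, hs⟩ := exists_eq_mul_of_cast_eq_zero (n := n) (l₀ := l₀) (p := p) (by omega)
      (by simpa using h)
    exact ⟨s, by rw [hs]⟩

lemma Mco_mul_eq_range (hn : 3 ≤ n) (hq : ∀ i j, q i j ≠ 0) (l₀ : ℕ) :
    Mco k n q (l₀ * n) =
      LinearMap.range (Fintype.linearCombination k (pairE k n q (l₀ + 1))) := by
  rw [Mco_eq_span hq, Fintype.range_linearCombination]
  have h1 := zmod_one_ne_zero hn
  have h2 := zmod_two_ne_zero hn
  congr 1
  ext x
  constructor
  · rintro ⟨p, i, j, y, hp, hy, rfl⟩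
    simp only [parallelSet, Nat.cast_mul, ZMod.natCast_self, mul_zero, Set.mem_ofPred_eq] at hy
    obtain ⟨hr, hs, rfl⟩ | ⟨hr, hs, rfl⟩ | ⟨hr, hs, rfl⟩ | ⟨hr, hs, rfl⟩ := hy
    · obtain ⟨s, rfl⟩ := exists_eq_mul_of_cast_eq_zero (l₀ := l₀) (by nlinarith) hr
      exact ⟨(s, i, j), rfl⟩
    · exact absurd (by linear_combination -hs - hr) h1
    · exact absurd (by linear_combination -hs - hr) h1
    · exact absurd (by linear_combination -hs - hr) h2
  · rintro ⟨⟨s, i, j⟩, rfl⟩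
    exact ⟨s * n, i, j, _, Nat.mul_le_mul_right n (Nat.lt_succ_iff.mp s.2),
      .inl ⟨by simp, by simp, rfl⟩, rfl⟩

lemma Mco_mul_add_one_eq_range (hn : 3 ≤ n) (hq : ∀ i j, q i j ≠ 0) (l₀ : ℕ) :
    Mco k n q (l₀ * n + 1) = LinearMap.range (Fintype.linearCombination k
      (Sum.elim (pairA k n q (l₀ + 1)) (pairB k n q (l₀ + 1)))) := by
  rw [Mco_eq_span hq, Fintype.range_linearCombination]
  have h1 := zmod_one_ne_zero hn
  congr 1
  ext x
  constructor
  · rintro ⟨p, i, j, y, hp, hy, rfl⟩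
    simp only [parallelSet, Nat.cast_mul, Nat.cast_add, Nat.cast_one, ZMod.natCast_self, mul_zero,
      zero_add, Set.mem_ofPred_eq] at hy
    obtain ⟨hr, hs, rfl⟩ | ⟨hr, hs, rfl⟩ | ⟨hr, hs, rfl⟩ | ⟨hr, hs, rfl⟩ := hy
    · exact absurd (by linear_combination hs + hr) h1
    · obtain ⟨s, rfl⟩ := exists_eq_mul_of_cast_eq_zero (l₀ := l₀) (by nlinarith) hr
      exact ⟨.inl (s, i, j), rfl⟩
    · obtain ⟨s, rfl⟩ := exists_eq_mul_add_one_of_cast_eq_one hn (l₀ := l₀) (by nlinarith) hr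
      exact ⟨.inr (s, i, j), rfl⟩
    · exact absurd (by linear_combination -hs - hr) h1
  · rintro ⟨⟨s, i, j⟩ | ⟨s, i, j⟩, rfl⟩
    · exact ⟨s * n, i, j, _, (Nat.mul_le_mul_right n (Nat.lt_succ_iff.mp s.2)).trans (Nat.le_succ _),
        .inr (.inl ⟨by simp, by simp, rfl⟩), rfl⟩
    · exact ⟨s * n + 1, i, j, _,
        Nat.succ_le_succ (Nat.mul_le_mul_right n (Nat.lt_succ_iff.mp s.2)),
        .inr (.inr (.inl ⟨by simp, by simp, rfl⟩)), rfl⟩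

lemma linearCombination_single_injective {ι α M : Type*} [Fintype ι] [AddCommGroup M] [Module k M]
    {g : ι → α} (hg : Function.Injective g) {u : ι → M} (hu : ∀ x, u x ≠ 0) :
    Function.Injective
      (Fintype.linearCombination k fun x => Finsupp.single (g x) (u x)) := by
  classical
  rw [injective_iff_map_eq_zero]
  intro f hf
  funext x
  have := DFunLike.congr_fun hf (g x)
  simpa [Fintype.linearCombination_apply, Finsupp.finsetSum_apply, Finsupp.single_apply,
    hg.eq_iff, hu x] using this

lemma fin_mul_inj {m : ℕ} {s t : Fin m} (h : (s : ℕ) * n = t * n) : s = t :=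
  Fin.ext (Nat.eq_of_mul_eq_mul_right (NeZero.pos n) h)

lemma fin_mul_ne {n : ℕ} (hn : 3 ≤ n) (s t : ℕ) : s * n ≠ t * n + 1 := fun h => by
  have h' := congrArg (Nat.cast : ℕ → ZMod n) h
  simp only [Nat.cast_mul, Nat.cast_add, ZMod.natCast_self, mul_zero, zero_add, Nat.cast_one] at h'
  exact zmod_one_ne_zero hn h'.symm

lemma linearCombination_pairA_pairB_injective (hn : 3 ≤ n) (hq : ∀ i j, q i j ≠ 0) (m : ℕ) :
    Function.Injective
      (Fintype.linearCombination k (Sum.elim (pairA k n q m) (pairB k n q m))) := by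
  have := linearCombination_single_injective (k := k)
    (g := Sum.elim (fun x : Fin m × ZMod n × ZMod n => ((x.1 * n : ℕ), x.2.1, x.2.2))
      (fun x : Fin m × ZMod n × ZMod n => (x.1 * n + 1, x.2.1, x.2.2)))
    (u := Sum.elim (fun x => gL k n q (.a x.2.1 x.2.2)) (fun x => gL k n q (.b x.2.1 x.2.2)))
    (by
      rintro (⟨s, i, j⟩ | ⟨s, i, j⟩) (⟨t, i', j'⟩ | ⟨t, i', j'⟩) h <;>
        simp only [Sum.elim_inl, Sum.elim_inr, Prod.mk.injEq] at h
      · obtain ⟨h, rfl, rfl⟩ := h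
        rw [fin_mul_inj h]
      · exact absurd h.1 (fin_mul_ne hn _ _)
      · exact absurd h.1.symm (fin_mul_ne hn _ _)
      · obtain ⟨h, rfl, rfl⟩ := h
        rw [fin_mul_inj (Nat.succ_injective h)])
    (by
      rintro (x | x)
      · exact a_ne_zero hn hq _ _
      · exact b_ne_zero hn hq _ _)
  convert this using 3
  funext x
  rcases x with x | x <;> rfl

lemma linearCombination_pairAB_injective (hn : 3 ≤ n) (hq : ∀ i j, q i j ≠ 0) (m : ℕ) :
    Function.Injective (Fintype.linearCombination k (pairAB k n q m)) := by
  refine linearCombination_single_injective (fun x y h => ?_) fun x => ab_ne_zero hn hq _ _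
  obtain ⟨s, i, j⟩ := x
  obtain ⟨t, i', j'⟩ := y
  simp only [Prod.mk.injEq] at h
  obtain ⟨h, rfl, rfl⟩ := h
  rw [fin_mul_inj (Nat.succ_injective h)]

variable (q) in
/-- The coefficients `(q_{i0} ⋯ q_{i,n-1})^{l₀-s}`. -/
def rowCoeff (l₀ : ℕ) (s : Fin (l₀ + 1)) (i : ZMod n) : k := (∏ j, q i j) ^ (l₀ - s : ℕ)

variable (q) in
/-- The coefficients `(q_{0j} ⋯ q_{n-1,j})^s`. -/
def colCoeff (l₀ : ℕ) (s : Fin (l₀ + 1)) (j : ZMod n) : k := (∏ i, q i j) ^ (s : ℕ)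

lemma mul_sub_mul_eq {n l₀ : ℕ} (s : Fin (l₀ + 1)) : l₀ * n - s * n = (l₀ - s) * n :=
  (Nat.sub_mul _ _ _).symm

lemma δco_pairE (l₀ : ℕ) (x : Fin (l₀ + 1) × ZMod n × ZMod n) :
    δco k n q (l₀ * n + 1) (pairE k n q (l₀ + 1) x) =
      pairA k n q (l₀ + 1) (shiftSnd.symm x) +
      rowCoeff q l₀ x.1 (x.2.1 - 1) • pairB k n q (l₀ + 1) (shiftFst.symm x) +
      (-1 : k) ^ (l₀ * n + 1) • pairB k n q (l₀ + 1) x +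
      ((-1 : k) ^ (l₀ * n + 1) * colCoeff q l₀ x.1 x.2.2) • pairA k n q (l₀ + 1) x := by
  obtain ⟨s, i, j⟩ := x
  have hs : l₀ * n + 1 - s * n - 1 = (l₀ - s) * n := by
    rw [← mul_sub_mul_eq]; omega
  have h1 := prod_range_mul_add_cast (fun t => q (i - 1) t) j (l₀ - s)
  have h2 := prod_range_mul_add_cast (fun t => q t j) i s
  have e1 : shiftSnd.symm (s, i, j) = (s, i, j - 1) := by
    rw [Equiv.symm_apply_eq]; simp [shiftSnd_apply]
  have e2 : shiftFst.symm (s, i, j) = (s, i - 1, j) := by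
    rw [Equiv.symm_apply_eq]; simp [shiftFst_apply]
  have e3 : j + ((l₀ * n + 1 : ℕ) : ZMod n) - ((s * n : ℕ) : ZMod n) - 1 = j := by simp
  have e4 : i + ((s * n : ℕ) : ZMod n) = i := by simp
  rw [pairE, δco_single, hs, h1, e3, e4, h2, e1, e2]
  have f1 := a_mul_e_self (k := k) (q := q) i (j - 1)
  have f2 := b_mul_e_self (k := k) (q := q) (i - 1) j
  rw [sub_add_cancel] at f1 f2
  rw [f1, f2, e_mul_a_self, e_mul_b_self]
  rfl

lemma δco_pairA (l₀ : ℕ) (x : Fin (l₀ + 1) × ZMod n × ZMod n) :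
    δco k n q (l₀ * n + 2) (pairA k n q (l₀ + 1) x) =
      (-1 : k) ^ (l₀ * n + 2) • pairAB k n q (l₀ + 1) x -
      rowCoeff q l₀ x.1 (x.2.1 - 1) • pairAB k n q (l₀ + 1) (shiftFst.symm x) := by
  obtain ⟨s, i, j⟩ := x
  have hs : l₀ * n + 2 - s * n - 1 = (l₀ - s) * n + 1 := by
    have : (s : ℕ) * n ≤ l₀ * n := Nat.mul_le_mul_right n (Nat.lt_succ_iff.mp s.2)
    rw [← mul_sub_mul_eq]; omega
  have h1 := prod_range_mul_add_cast (fun t => q (i - 1) t) j (l₀ - s)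
  have e2 : shiftFst.symm (s, i, j) = (s, i - 1, j) := by
    rw [Equiv.symm_apply_eq]; simp [shiftFst_apply]
  have e3 : j + ((l₀ * n + 2 : ℕ) : ZMod n) - ((s * n : ℕ) : ZMod n) - 1 = j + 1 := by
    push_cast; simp; ring
  have e4 : i + ((s * n : ℕ) : ZMod n) = i := by simp
  have e5 : (((l₀ - s) * n : ℕ) : ZMod n) = 0 := by
    rw [Nat.cast_mul, ZMod.natCast_self, mul_zero]
  have f2 := q_smul_b_mul_a (k := k) (q := q) (i - 1) j
  rw [sub_add_cancel] at f2
  rw [pairA, δco_single, hs, Finset.prod_range_succ, h1, e3, e4, e2, e5, add_zero, a_mul_a,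
    a_mul_a, mul_smul, Finsupp.smul_single (q (i - 1) j), f2]
  simp only [Finsupp.single_zero, smul_zero, add_zero, zero_add, Finsupp.single_neg, smul_neg]
  rw [add_comm, ← sub_eq_add_neg]
  rfl

lemma δco_pairB (l₀ : ℕ) (x : Fin (l₀ + 1) × ZMod n × ZMod n) :
    δco k n q (l₀ * n + 2) (pairB k n q (l₀ + 1) x) =
      pairAB k n q (l₀ + 1) (shiftSnd.symm x) -
      ((-1 : k) ^ (l₀ * n + 2) * colCoeff q l₀ x.1 x.2.2) • pairAB k n q (l₀ + 1) x := by
  obtain ⟨s, i, j⟩ := x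
  have h2 := prod_range_mul_add_cast (fun t => q t j) i s
  have e1 : shiftSnd.symm (s, i, j) = (s, i, j - 1) := by
    rw [Equiv.symm_apply_eq]; simp [shiftSnd_apply]
  have e3 : j + ((l₀ * n + 2 : ℕ) : ZMod n) - ((s * n + 1 : ℕ) : ZMod n) - 1 = j := by
    push_cast; simp; ring
  have e4 : i + ((s * n + 1 : ℕ) : ZMod n) = i + 1 := by simp
  have e5 : i + ((s * n : ℕ) : ZMod n) = i := by simp
  rw [pairB, δco_single, e3, e4, e1, Finset.prod_range_succ, h2, e5, b_mul_b, b_mul_b, ← mul_assoc,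
    mul_smul _ (q i j), Finsupp.smul_single (q i j), q_smul_b_mul_a]
  simp only [Finsupp.single_zero, smul_zero, add_zero, Finsupp.single_neg, smul_neg]
  rw [← sub_eq_add_neg]
  simp only [pairAB, sub_add_cancel]
  rfl

lemma δco_comp_pairE (l₀ : ℕ) :
    δco k n q (l₀ * n + 1) ∘ₗ Fintype.linearCombination k (pairE k n q (l₀ + 1)) =
      Fintype.linearCombination k (Sum.elim (pairA k n q (l₀ + 1)) (pairB k n q (l₀ + 1))) ∘ₗ
        gradMap ((-1) ^ (l₀ * n + 1)) (rowCoeff q l₀) (colCoeff q l₀) := by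
  refine LinearMap.ext fun f => ?_
  have h1 := shiftSnd.sum_comp fun x => f x • pairA k n q (l₀ + 1) (shiftSnd.symm x)
  have h2 := shiftFst.sum_comp fun x =>
    f x • rowCoeff q l₀ x.1 (x.2.1 - 1) • pairB k n q (l₀ + 1) (shiftFst.symm x)
  simp only [Equiv.symm_apply_apply] at h1 h2
  simp only [shiftSnd_apply, shiftFst_apply, add_sub_cancel_right, smul_smul] at h1 h2
  simp only [LinearMap.comp_apply, Fintype.linearCombination_apply, map_sum, map_smul, δco_pairE,
    smul_add, Finset.sum_add_distrib, Fintype.sum_sum_type, Sum.elim_inl, Sum.elim_inr, gradMap,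
    LinearMap.coe_mk, AddHom.coe_mk, add_smul, smul_smul]
  rw [← h1, ← h2]
  simp only [mul_comm]
  abel

lemma δco_comp_pairA_pairB (l₀ : ℕ) :
    δco k n q (l₀ * n + 2) ∘ₗ
        Fintype.linearCombination k (Sum.elim (pairA k n q (l₀ + 1)) (pairB k n q (l₀ + 1))) =
      Fintype.linearCombination k (pairAB k n q (l₀ + 1)) ∘ₗ
        divMap ((-1) ^ (l₀ * n + 2)) (rowCoeff q l₀) (colCoeff q l₀) := by
  refine LinearMap.ext fun f => ?_
  have h1 := shiftSnd.sum_comp fun x => f (.inr x) • pairAB k n q (l₀ + 1) (shiftSnd.symm x)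
  have h2 := shiftFst.sum_comp fun x =>
    f (.inl x) • rowCoeff q l₀ x.1 (x.2.1 - 1) • pairAB k n q (l₀ + 1) (shiftFst.symm x)
  simp only [Equiv.symm_apply_apply] at h1 h2
  simp only [shiftSnd_apply, shiftFst_apply, add_sub_cancel_right, smul_smul] at h1 h2
  simp only [LinearMap.comp_apply, Fintype.linearCombination_apply, map_add, map_sum, map_smul,
    δco_pairA, δco_pairB, smul_sub, Finset.sum_sub_distrib, Finset.sum_add_distrib,
    Fintype.sum_sum_type, Sum.elim_inl, Sum.elim_inr, divMap,
    LinearMap.coe_mk, AddHom.coe_mk, add_smul, sub_smul, smul_smul]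
  rw [← h1, ← h2]
  simp only [mul_comm, mul_left_comm]

lemma prod_colCoeff_prod_rowCoeff
    (hξ : ∀ r : ℕ, 1 ≤ r → (∏ i : ZMod n, ∏ j : ZMod n, q i j) ^ r ≠ 1) {l₀ : ℕ} (hl : l₀ ≠ 0)
    (s : Fin (l₀ + 1)) :
    (∏ x, colCoeff q l₀ s x) ^ 2 ≠ 1 ∨ (∏ x, rowCoeff q l₀ s x) ^ 2 ≠ 1 := by
  simp only [colCoeff, rowCoeff, Finset.prod_pow, ← pow_mul]
  by_cases hs : (s : ℕ) = 0
  · exact .inr (hξ _ (by omega))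
  · rw [Finset.prod_comm]
    exact .inl (hξ _ (by omega))

lemma finrank_map_δco_mul_add_one (hn : 3 ≤ n) (hq : ∀ i j, q i j ≠ 0)
    (hξ : ∀ r : ℕ, 1 ≤ r → (∏ i : ZMod n, ∏ j : ZMod n, q i j) ^ r ≠ 1) (l₀ : ℕ) :
    Module.finrank k (Submodule.map (δco k n q (l₀ * n + 1)) (Mco k n q (l₀ * n))) =
      if l₀ = 0 then n ^ 2 - 1 else (l₀ + 1) * n ^ 2 := by
  rw [Mco_mul_eq_range hn hq, ← LinearMap.range_comp, δco_comp_pairE, LinearMap.range_comp,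
    ← (Submodule.equivMapOfInjective _
      (linearCombination_pairA_pairB_injective hn hq (l₀ + 1)) _).finrank_eq]
  split_ifs with hl
  · subst hl
    have hr : rowCoeff q 0 = fun _ _ => 1 := by funext s i; simp [rowCoeff]
    have hc : colCoeff q 0 = fun _ _ => 1 := by
      funext s i; simp [colCoeff]
    rw [hr, hc, zero_mul, zero_add, pow_one]
    exact finrank_range_gradMap_one
  · rw [LinearMap.finrank_range_of_inj (gradMap_injective (by simp [← pow_mul, mul_comm _ 2])
      (prod_colCoeff_prod_rowCoeff hξ hl))]
    simp [sq]

lemma finrank_map_δco_mul_add_two (hn : 3 ≤ n) (hq : ∀ i j, q i j ≠ 0)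
    (hξ : ∀ r : ℕ, 1 ≤ r → (∏ i : ZMod n, ∏ j : ZMod n, q i j) ^ r ≠ 1) (l₀ : ℕ) :
    Module.finrank k (Submodule.map (δco k n q (l₀ * n + 2)) (Mco k n q (l₀ * n + 1))) =
      if l₀ = 0 then n ^ 2 - 1 else (l₀ + 1) * n ^ 2 := by
  rw [Mco_mul_add_one_eq_range hn hq, ← LinearMap.range_comp, δco_comp_pairA_pairB,
    LinearMap.range_comp, ← (Submodule.equivMapOfInjective _
      (linearCombination_pairAB_injective hn hq (l₀ + 1)) _).finrank_eq]
  split_ifs with hl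
  · subst hl
    have hr : rowCoeff q 0 = fun _ _ => 1 := by funext s i; simp [rowCoeff]
    have hc : colCoeff q 0 = fun _ _ => 1 := by
      funext s i; simp [colCoeff]
    rw [hr, hc, zero_mul, zero_add, neg_one_sq]
    exact finrank_range_divMap_one
  · rw [LinearMap.range_eq_top.mpr (divMap_surjective (by simp [← pow_mul, mul_comm _ 2])
      (prod_colCoeff_prod_rowCoeff hξ hl)), finrank_top]
    simp [sq]

lemma map_δco_eq_bot (hn : 3 ≤ n) (hq : ∀ i j, q i j ≠ 0) {l : ℕ} (hl : 1 ≤ l)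
    (h1 : l % n ≠ 1) (h2 : l % n ≠ 2) :
    Submodule.map (δco k n q l) (Mco k n q (l - 1)) = ⊥ := by
  obtain ⟨l, rfl⟩ := Nat.exists_eq_add_of_le' hl
  have mod_eq : ∀ r : ℕ, r < n → ((l + 1 : ℕ) : ZMod n) = r → (l + 1) % n = r := fun r hr h => by
    rw [← Nat.mod_eq_of_lt hr]
    exact (ZMod.natCast_eq_natCast_iff' _ _ _).mp h
  rw [Nat.add_sub_cancel, Mco_eq_span hq, eq_bot_iff, Submodule.map_span, Submodule.span_le]
  rintro _ ⟨_, ⟨p, i, j, y, hp, hy, rfl⟩, rfl⟩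
  obtain ⟨hr, hs, rfl⟩ | ⟨hr, hs, rfl⟩ | ⟨hr, hs, rfl⟩ | ⟨hr, hs, rfl⟩ := hy
  · exact absurd (mod_eq 1 (by omega) (by push_cast; linear_combination hr + hs)) h1
  · exact absurd (mod_eq 2 (by omega) (by push_cast; linear_combination hr + hs)) h2
  · exact absurd (mod_eq 2 (by omega) (by push_cast; linear_combination hr + hs)) h2
  · rw [δco_single, a_mul_ab, b_mul_ab hq, ab_mul_b, ab_mul_a hq]
    simp

end Cochains

end TorusKoszul

/-- **Statement 9.**  Suppose `n ≥ 3` and `ξ = Π_{i,j} q_{ij}` is not a root of unity.  Then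
`dim_k Im δ^{l₀n+1}` is `n² − 1` for `l₀ = 0` and `(l₀+1) n²` for `l₀ ≥ 1`, and likewise for
`dim_k Im δ^{l₀n+2}`; moreover `δ^l = 0` whenever `l` is not congruent to `1` or `2` mod `n`. -/
theorem stmt_9 (k : Type) [Field k] (n : ℕ) [NeZero n] (hn : 3 ≤ n)
    (q : ZMod n → ZMod n → k) (hq : ∀ i j, q i j ≠ 0)
    (hξ : ∀ r : ℕ, 1 ≤ r → (∏ i : ZMod n, ∏ j : ZMod n, q i j) ^ r ≠ 1) :
    (∀ l₀ : ℕ,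
      Module.finrank k
          (Submodule.map (δco k n q (l₀ * n + 1)) (Mco k n q (l₀ * n))) =
        if l₀ = 0 then n ^ 2 - 1 else (l₀ + 1) * n ^ 2) ∧
    (∀ l₀ : ℕ,
      Module.finrank k
          (Submodule.map (δco k n q (l₀ * n + 2)) (Mco k n q (l₀ * n + 1))) =
        if l₀ = 0 then n ^ 2 - 1 else (l₀ + 1) * n ^ 2) ∧
    (∀ l : ℕ, 1 ≤ l → l % n ≠ 1 → l % n ≠ 2 →
      Submodule.map (δco k n q l) (Mco k n q (l - 1)) = ⊥) := by
  exact ⟨TorusKoszul.finrank_map_δco_mul_add_one hn hq hξ,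
    TorusKoszul.finrank_map_δco_mul_add_two hn hq hξ,
    fun _ hl h1 h2 => TorusKoszul.map_δco_eq_bot hn hq hl h1 h2⟩
end
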